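/- arXiv:1212.5481 — 9 statements merged into one kernel-verified Lean document; each statement's English description precedes it below -/
import Mathlib

section
/- Let φ : (0,∞) → (0,∞) be continuous, α : (0,∞) → (0,∞), and θ > δ > 0 be such that ∫_a^{α(a)} ds/φ(s) ≤ θ − δ for every a > 0 (the integral is oriented, so it is negative when α(a) < a). Fix r > 0 and set F(q) = ∫_r^q ds/φ(s). Let t_i < t_{i+1} with t_{i+1} − t_i ≥ θ, let y : [t_i, t_{i+1}) → (0,∞) be differentiable with y′(t) ≤ −φ(y(t)) for all t, suppose the left limit y⁻ := lim_{t→t_{i+1}^-} y(t) exists and is positive, and let y₊ > 0 satisfy y₊ ≤ α(y⁻). Then F(y₊) ≤ F(y(t_i)) − δ; in particular y₊ < y(t_i). -/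
open Set Filter Topology intervalIntegral

/-- The reciprocal of a function continuous and positive on `(0, ∞)` is interval integrable between
positive endpoints. -/
theorem intervalIntegrable_one_div_of_pos {φ : ℝ → ℝ} (hφc : ContinuousOn φ (Ioi 0))
    (hφpos : ∀ s > (0 : ℝ), 0 < φ s) {a b : ℝ} (ha : 0 < a) (hb : 0 < b) :
    IntervalIntegrable (fun s => 1 / φ s) MeasureTheory.volume a b := by
  have hsub : uIcc a b ⊆ Ioi 0 := fun x hx => (lt_min ha hb).trans_le hx.1
  exact (continuousOn_const.div (hφc.mono hsub)
    fun x hx => (hφpos x (hsub hx)).ne').intervalIntegrable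

/-- The primitive of `1 / φ` has derivative `1 / φ q` at every `q > 0`. -/
theorem hasDerivAt_integral_one_div {φ : ℝ → ℝ} (hφc : ContinuousOn φ (Ioi 0))
    (hφpos : ∀ s > (0 : ℝ), 0 < φ s) {r q : ℝ} (hr : 0 < r) (hq : 0 < q) :
    HasDerivAt (fun x => ∫ s in r..x, 1 / φ s) (1 / φ q) q := by
  have hc : ContinuousOn (fun s => 1 / φ s) (Ioi 0) :=
    continuousOn_const.div hφc fun x hx => (hφpos x hx).ne'
  exact integral_hasDerivAt_right (intervalIntegrable_one_div_of_pos hφc hφpos hr hq)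
    (hc.stronglyMeasurableAtFilter isOpen_Ioi q hq) (hc.continuousAt (Ioi_mem_nhds hq))

/-- The primitive of `1 / φ` is strictly increasing on `(0, ∞)`. -/
theorem strictMonoOn_integral_one_div {φ : ℝ → ℝ} (hφc : ContinuousOn φ (Ioi 0))
    (hφpos : ∀ s > (0 : ℝ), 0 < φ s) {r : ℝ} (hr : 0 < r) :
    StrictMonoOn (fun x => ∫ s in r..x, 1 / φ s) (Ioi 0) := by
  refine strictMonoOn_of_deriv_pos (convex_Ioi 0)
    (fun q hq => (hasDerivAt_integral_one_div hφc hφpos hr hq).continuousAt.continuousWithinAt)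
    fun q hq => ?_
  rw [interior_Ioi] at hq
  rw [(hasDerivAt_integral_one_div hφc hφpos hr hq).deriv]
  exact one_div_pos.2 (hφpos q hq)

/-- Along a positive solution of `y' ≤ -φ(y)`, the primitive of `1 / φ` decreases at unit rate. -/
theorem antitoneOn_integral_one_div_add {φ : ℝ → ℝ} (hφc : ContinuousOn φ (Ioi 0))
    (hφpos : ∀ s > (0 : ℝ), 0 < φ s) {r : ℝ} (hr : 0 < r) {a b : ℝ} {y : ℝ → ℝ}
    (hy : ∀ t ∈ Ico a b, 0 < y t) (hyd : ∀ t ∈ Ico a b, DifferentiableAt ℝ y t)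
    (hyd' : ∀ t ∈ Ico a b, deriv y t ≤ -φ (y t)) :
    AntitoneOn (fun t => (∫ s in r..y t, 1 / φ s) + t) (Ico a b) := by
  have hd : ∀ t ∈ Ico a b, HasDerivAt (fun t => (∫ s in r..y t, 1 / φ s) + t)
      (1 / φ (y t) * deriv y t + 1) t := fun t ht =>
    ((hasDerivAt_integral_one_div hφc hφpos hr (hy t ht)).comp t
      (hyd t ht).hasDerivAt).add (hasDerivAt_id t)
  refine antitoneOn_of_deriv_nonpos (convex_Ico a b)
    (fun t ht => (hd t ht).continuousAt.continuousWithinAt)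
    (fun t ht => (hd t (interior_subset ht)).differentiableAt.differentiableWithinAt)
    fun t ht => ?_
  replace ht := interior_subset ht
  have hpos := hφpos _ (hy t ht)
  rw [(hd t ht).deriv, one_div_mul_eq_div]
  have : deriv y t / φ (y t) ≤ -1 := by
    rw [div_le_iff₀ hpos]
    linarith [hyd' t ht]
  linarith

/-- single-step decrement estimate under the nonlinear fixed
dwell-time condition `∫_a^{α(a)} ds/φ(s) ≤ θ - δ`. -/
theorem stmt_2 (φ : ℝ → ℝ) (hφc : ContinuousOn φ (Set.Ioi 0))
    (hφpos : ∀ s > (0:ℝ), 0 < φ s)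
    (α : ℝ → ℝ) (hα : ∀ a > (0:ℝ), 0 < α a)
    (θ δ : ℝ) (hδ : 0 < δ) (hθ : δ < θ)
    (hFDT : ∀ a > (0:ℝ), (∫ s in a..(α a), 1 / φ s) ≤ θ - δ)
    (r : ℝ) (hr : 0 < r)
    (ti ti1 : ℝ) (hti : ti < ti1) (hgap : θ ≤ ti1 - ti)
    (y : ℝ → ℝ) (hy : ∀ t ∈ Set.Ico ti ti1, 0 < y t)
    (hyd : ∀ t ∈ Set.Ico ti ti1, DifferentiableAt ℝ y t)
    (hyd' : ∀ t ∈ Set.Ico ti ti1, deriv y t ≤ -φ (y t))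
    (yL : ℝ) (hyL : Filter.Tendsto y (nhdsWithin ti1 (Set.Iio ti1)) (nhds yL))
    (hyLpos : 0 < yL)
    (yp : ℝ) (hyp : 0 < yp) (hypα : yp ≤ α yL) :
    (∫ s in r..yp, 1 / φ s) ≤ (∫ s in r..(y ti), 1 / φ s) - δ ∧ yp < y ti := by
  have hmono := strictMonoOn_integral_one_div hφc hφpos hr
  have hflow : (∫ s in r..yL, 1 / φ s) + ti1 ≤ (∫ s in r..y ti, 1 / φ s) + ti := by
    refine le_of_tendsto
      (((hasDerivAt_integral_one_div hφc hφpos hr hyLpos).continuousAt.tendsto.comp hyL).add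
        (tendsto_id.mono_left nhdsWithin_le_nhds)) ?_
    filter_upwards [Ioo_mem_nhdsLT hti] with t ht
    exact antitoneOn_integral_one_div_add hφc hφpos hr hy hyd hyd'
      (left_mem_Ico.2 hti) (Ioo_subset_Ico_self ht) ht.1.le
  have hjump : (∫ s in r..yp, 1 / φ s) ≤ ∫ s in r..α yL, 1 / φ s :=
    hmono.monotoneOn hyp (hα yL hyLpos) hypα
  have hsplit := integral_add_adjacent_intervals
    (intervalIntegrable_one_div_of_pos hφc hφpos hr hyLpos)
    (intervalIntegrable_one_div_of_pos hφc hφpos hyLpos (hα yL hyLpos))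
  have hmain : (∫ s in r..yp, 1 / φ s) ≤ (∫ s in r..y ti, 1 / φ s) - δ := by
    linarith [hFDT yL hyLpos]
  refine ⟨hmain, (hmono.lt_iff_lt hyp (hy ti (left_mem_Ico.2 hti))).1 ?_⟩
  show (∫ s in r..yp, 1 / φ s) < ∫ s in r..y ti, 1 / φ s
  linarith
end

section
/- Let β₁ : [0,∞) × [0,∞) → [0,∞) satisfy: β₁(0,t) = 0 for all t ≥ 0; for each t ≥ 0 the function β₁(·,t) is nondecreasing with lim_{r→0+} β₁(r,t) = 0; and for each r > 0 the function β₁(r,·) is continuous, nonincreasing and tends to 0 as t → ∞. Define β₂(0,t) := 0 and β₂(r,t) := (1/r)∫_r^{2r} β₁(s,t) ds + r e^{−t} for r > 0, t ≥ 0. Then β₂ is of class KL and β₂(r,t) ≥ β₁(r,t) for all r, t ≥ 0. -/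
open Set Filter Topology intervalIntegral

/-- A class `K` function: continuous, strictly increasing on `[0,∞)` with `γ(0) = 0`. -/
def ClassK (γ : ℝ → ℝ) : Prop :=
  ContinuousOn γ (Set.Ici 0) ∧ StrictMonoOn γ (Set.Ici 0) ∧ γ 0 = 0

/-- A class `L` function: continuous, strictly decreasing on `[0,∞)` and tending
to `0` at infinity. -/
def ClassL (g : ℝ → ℝ) : Prop :=
  ContinuousOn g (Set.Ici 0) ∧ StrictAntiOn g (Set.Ici 0) ∧
    Filter.Tendsto g Filter.atTop (nhds 0)

/-- A class `KL` function. -/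
def ClassKL (β : ℝ → ℝ → ℝ) : Prop :=
  ContinuousOn (fun p : ℝ × ℝ => β p.1 p.2) (Set.Ici 0 ×ˢ Set.Ici 0) ∧
  (∀ t ≥ (0:ℝ), ClassK fun r => β r t) ∧
  (∀ r > (0:ℝ), ClassL fun t => β r t)

/-- A function on the quadrant that is monotone in the first variable and continuous in the second
is jointly continuous at every point where it is continuous in the first variable. -/
theorem continuousWithinAt_quadrant_of_monotoneOn {f : ℝ → ℝ → ℝ}
    (hmono : ∀ t ≥ (0 : ℝ), MonotoneOn (fun r => f r t) (Ici 0))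
    (hcont : ∀ r ≥ (0 : ℝ), ContinuousOn (f r) (Ici 0)) {s t : ℝ} (hs : 0 ≤ s) (ht : 0 ≤ t)
    (hst : ContinuousWithinAt (fun r => f r t) (Ici 0) s) :
    ContinuousWithinAt (fun p : ℝ × ℝ => f p.1 p.2) (Ici 0 ×ˢ Ici 0) (s, t) := by
  have hfst : Tendsto (fun p : ℝ × ℝ => p.1) (𝓝[Ici 0 ×ˢ Ici 0] (s, t)) (𝓝 s) :=
    continuous_fst.continuousWithinAt
  have hsnd : Tendsto (fun p : ℝ × ℝ => p.2) (𝓝[Ici 0 ×ˢ Ici 0] (s, t)) (𝓝[Ici 0] t) :=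
    tendsto_nhdsWithin_of_tendsto_nhds_of_eventually_within _
      continuous_snd.continuousWithinAt
      (eventually_mem_nhdsWithin.mono fun p hp => hp.2)
  refine tendsto_order.2 ⟨fun a ha => ?_, fun a ha => ?_⟩
  · obtain ⟨δ, hδ, h⟩ := Metric.mem_nhdsWithin_iff.1 (hst.eventually (lt_mem_nhds ha))
    have hlow : a < f (max 0 (s - δ / 2)) t := by
      refine h ⟨?_, mem_Ici.2 (le_max_left _ _)⟩
      rw [Metric.mem_ball, Real.dist_eq, abs_lt]
      constructor
      · linarith [le_max_right 0 (s - δ / 2)]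
      · linarith [max_le hs (show s - δ / 2 ≤ s by linarith)]
    have hev := hsnd.eventually
      ((hcont _ (le_max_left 0 (s - δ / 2)) t ht).eventually (lt_mem_nhds hlow))
    filter_upwards [hev, hfst.eventually (lt_mem_nhds (show s - δ / 2 < s by linarith)),
      eventually_mem_nhdsWithin] with p hp hp1 hp2
    exact hp.trans_le (hmono _ hp2.2 (mem_Ici.2 (le_max_left _ _)) hp2.1 (max_le hp2.1 hp1.le))
  · obtain ⟨δ, hδ, h⟩ := Metric.mem_nhdsWithin_iff.1 (hst.eventually (gt_mem_nhds ha))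
    have hs' : 0 ≤ s + δ / 2 := by linarith
    have hupp : f (s + δ / 2) t < a := by
      refine h ⟨?_, hs'⟩
      rw [Metric.mem_ball, Real.dist_eq, abs_lt]
      constructor <;> linarith
    have hev := hsnd.eventually ((hcont _ hs' t ht).eventually (gt_mem_nhds hupp))
    filter_upwards [hev, hfst.eventually (gt_mem_nhds (show s < s + δ / 2 by linarith)),
      eventually_mem_nhdsWithin] with p hp hp1 hp2
    exact (hmono _ hp2.2 hp2.1 hs' hp1.le).trans_lt hp

/-- Nonnegative rescalings of a function monotone on `[0,∞)` are integrable on `[1, 2]`. -/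
theorem MonotoneOn.intervalIntegrable_comp_mul_left {g : ℝ → ℝ} (hg : MonotoneOn g (Ici 0))
    {r : ℝ} (hr : 0 ≤ r) :
    IntervalIntegrable (fun u => g (r * u)) MeasureTheory.volume 1 2 := by
  refine MonotoneOn.intervalIntegrable fun u hu v hv huv => ?_
  rw [uIcc_of_le one_le_two] at hu hv
  exact hg (mul_nonneg hr (by linarith [hu.1])) (mul_nonneg hr (by linarith [hv.1]))
    (mul_le_mul_of_nonneg_left huv hr)

/-- Averaging a function that is monotone in the first variable and continuous and antitone in the
second over `[r, 2r]` gives a jointly continuous function on the quadrant. -/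
theorem continuousOn_integral_comp_mul_left {f : ℝ → ℝ → ℝ}
    (hmono : ∀ t ≥ (0 : ℝ), MonotoneOn (fun r => f r t) (Ici 0))
    (hcont : ∀ r ≥ (0 : ℝ), ContinuousOn (f r) (Ici 0))
    (hanti : ∀ r ≥ (0 : ℝ), AntitoneOn (f r) (Ici 0))
    (hnn : ∀ r ≥ (0 : ℝ), ∀ t ≥ (0 : ℝ), 0 ≤ f r t)
    (hzero : ∀ t ≥ (0 : ℝ), ContinuousWithinAt (fun r => f r t) (Ici 0) 0) :
    ContinuousOn (fun p : ℝ × ℝ => ∫ u in (1 : ℝ)..2, f (p.1 * u) p.2) (Ici 0 ×ˢ Ici 0) := by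
  rintro ⟨r, t⟩ ⟨hr, ht⟩
  rw [mem_Ici] at hr ht
  have hcountable : {u : ℝ | 0 ≤ u ∧
      ¬ ContinuousWithinAt (fun r => f r t) (Ici 0) (r * u)}.Countable := by
    rcases hr.eq_or_lt with rfl | hr
    · simp [hzero t ht]
    · refine ((hmono t ht).countable_not_continuousWithinAt.preimage
        (mul_right_injective₀ hr.ne')).mono fun u hu => ?_
      exact ⟨mul_nonneg hr.le hu.1, hu.2⟩
  refine intervalIntegral.tendsto_integral_filter_of_dominated_convergence
    (fun _ => f ((r + 1) * 2) 0) ?_ ?_ intervalIntegrable_const ?_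
  · filter_upwards [eventually_mem_nhdsWithin] with p hp
    simpa using ((hmono _ hp.2).intervalIntegrable_comp_mul_left hp.1).def'.aestronglyMeasurable
  · have hfst : Tendsto (fun p : ℝ × ℝ => p.1) (𝓝[Ici 0 ×ˢ Ici 0] (r, t)) (𝓝 r) :=
      continuous_fst.continuousWithinAt
    filter_upwards [eventually_mem_nhdsWithin,
      hfst.eventually (gt_mem_nhds (lt_add_one r))] with p hp hpr
    refine .of_forall fun u hu => ?_
    rw [uIoc_of_le one_le_two] at hu
    have hp1 : 0 ≤ p.1 := hp.1
    have hu0 : 0 ≤ u := by linarith [hu.1]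
    have hpu : 0 ≤ p.1 * u := mul_nonneg hp1 hu0
    have hr2 : 0 ≤ (r + 1) * 2 := by linarith
    rw [Real.norm_of_nonneg (hnn _ hpu _ hp.2)]
    exact (hanti _ hpu self_mem_Ici hp.2 hp.2).trans
      (hmono 0 le_rfl hpu hr2 (mul_le_mul hpr.le hu.2 hu0 (by linarith)))
  · filter_upwards [hcountable.ae_notMem MeasureTheory.volume] with u hu hu'
    rw [uIoc_of_le one_le_two] at hu'
    have hu0 : 0 ≤ u := by linarith [hu'.1]
    have hc : ContinuousWithinAt (fun r => f r t) (Ici 0) (r * u) := by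
      by_contra h
      exact hu ⟨hu0, h⟩
    refine (continuousWithinAt_quadrant_of_monotoneOn hmono hcont (mul_nonneg hr hu0) ht
      hc).tendsto.comp (f := fun p : ℝ × ℝ => (p.1 * u, p.2)) ?_
    refine ContinuousWithinAt.tendsto_nhdsWithin (x := (r, t)) ?_ ?_
    · fun_prop
    · exact fun p hp => ⟨mul_nonneg hp.1 hu0, hp.2⟩

/-- the smoothing/majorization
`β₂(r,t) = (1/r)∫_r^{2r} β₁(s,t) ds + r e^{-t}` produces a `KL`-function
majorizing `β₁`. -/
theorem stmt_4 (β₁ : ℝ → ℝ → ℝ)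
    (hnn : ∀ r ≥ (0:ℝ), ∀ t ≥ (0:ℝ), 0 ≤ β₁ r t)
    (h0 : ∀ t ≥ (0:ℝ), β₁ 0 t = 0)
    (hmono : ∀ t ≥ (0:ℝ), MonotoneOn (fun r => β₁ r t) (Set.Ici 0))
    (hlim0 : ∀ t ≥ (0:ℝ),
      Filter.Tendsto (fun r => β₁ r t) (nhdsWithin 0 (Set.Ioi 0)) (nhds 0))
    (hcont : ∀ r > (0:ℝ), ContinuousOn (β₁ r) (Set.Ici 0))
    (hanti : ∀ r > (0:ℝ), AntitoneOn (β₁ r) (Set.Ici 0))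
    (hliminf : ∀ r > (0:ℝ), Filter.Tendsto (β₁ r) Filter.atTop (nhds 0))
    (β₂ : ℝ → ℝ → ℝ)
    (hβ₂0 : ∀ t : ℝ, β₂ 0 t = 0)
    (hβ₂ : ∀ r > (0:ℝ), ∀ t : ℝ,
      β₂ r t = (1/r) * (∫ s in r..(2*r), β₁ s t) + r * Real.exp (-t)) :
    ClassKL β₂ ∧ ∀ r ≥ (0:ℝ), ∀ t ≥ (0:ℝ), β₁ r t ≤ β₂ r t := by
  have hcont' : ∀ r ≥ (0 : ℝ), ContinuousOn (β₁ r) (Ici 0) := fun r hr => by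
    rcases hr.eq_or_lt with rfl | hr
    · exact (continuousOn_const (c := (0 : ℝ))).congr h0
    · exact hcont r hr
  have hanti' : ∀ r ≥ (0 : ℝ), AntitoneOn (β₁ r) (Ici 0) := fun r hr => by
    rcases hr.eq_or_lt with rfl | hr
    · exact fun s hs t ht _ => by rw [h0 s hs, h0 t ht]
    · exact hanti r hr
  have hzero : ∀ t ≥ (0 : ℝ), ContinuousWithinAt (fun r => β₁ r t) (Ici 0) 0 := fun t ht => by
    rw [← Ioi_insert, continuousWithinAt_insert_self]
    simpa [ContinuousWithinAt, h0 t ht] using hlim0 t ht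
  have hint : ∀ r ≥ (0 : ℝ), ∀ t ≥ (0 : ℝ),
      IntervalIntegrable (fun u => β₁ (r * u) t) MeasureTheory.volume 1 2 := fun r hr t ht =>
    (hmono t ht).intervalIntegrable_comp_mul_left hr
  have hrep : ∀ r ≥ (0 : ℝ), ∀ t ≥ (0 : ℝ),
      β₂ r t = (∫ u in (1 : ℝ)..2, β₁ (r * u) t) + r * Real.exp (-t) := fun r hr t ht => by
    rcases hr.eq_or_lt with rfl | hr
    · simp [hβ₂0, h0 t ht]
    · rw [hβ₂ r hr, integral_comp_mul_left (fun s => β₁ s t) hr.ne', smul_eq_mul, mul_one,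
        one_div, mul_comm 2 r]
  have hjoint : ContinuousOn (fun p : ℝ × ℝ => β₂ p.1 p.2) (Ici 0 ×ˢ Ici 0) :=
    ((continuousOn_integral_comp_mul_left hmono hcont' hanti' hnn hzero).add
      (g := fun p : ℝ × ℝ => p.1 * Real.exp (-p.2)) (by fun_prop)).congr
      fun p hp => hrep p.1 hp.1 p.2 hp.2
  have hlower : ∀ r ≥ (0 : ℝ), ∀ t ≥ (0 : ℝ), β₁ r t ≤ β₂ r t := fun r hr t ht => by
    have h : (∫ _ in (1 : ℝ)..2, β₁ r t) ≤ ∫ u in (1 : ℝ)..2, β₁ (r * u) t :=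
      integral_mono_on one_le_two intervalIntegrable_const (hint r hr t ht) fun u hu =>
        hmono t ht hr (mul_nonneg hr (by linarith [hu.1])) (le_mul_of_one_le_right hr hu.1)
    rw [integral_const, smul_eq_mul] at h
    rw [hrep r hr t ht]
    linarith [mul_nonneg hr (Real.exp_pos (-t)).le]
  have hupper : ∀ r ≥ (0 : ℝ), ∀ t ≥ (0 : ℝ), β₂ r t ≤ β₁ (r * 2) t + r * Real.exp (-t) :=
    fun r hr t ht => by
    have h : (∫ u in (1 : ℝ)..2, β₁ (r * u) t) ≤ ∫ _ in (1 : ℝ)..2, β₁ (r * 2) t :=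
      integral_mono_on one_le_two (hint r hr t ht) intervalIntegrable_const fun u hu =>
        hmono t ht (mul_nonneg hr (by linarith [hu.1])) (mul_nonneg hr zero_le_two)
          (mul_le_mul_of_nonneg_left hu.2 hr)
    rw [integral_const, smul_eq_mul] at h
    rw [hrep r hr t ht]
    linarith
  refine ⟨⟨hjoint, fun t ht => ⟨?_, fun r hr s hs hrs => ?_, hβ₂0 t⟩,
    fun r hr => ⟨?_, fun s hs t ht hst => ?_, ?_⟩⟩, hlower⟩
  · exact hjoint.comp (f := fun r : ℝ => (r, t)) (by fun_prop) fun r hr => ⟨hr, ht⟩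
  · rw [mem_Ici] at hr hs
    have h : (∫ u in (1 : ℝ)..2, β₁ (r * u) t) ≤ ∫ u in (1 : ℝ)..2, β₁ (s * u) t :=
      integral_mono_on one_le_two (hint r hr t ht) (hint s hs t ht) fun u hu => by
        have hu0 : 0 ≤ u := by linarith [hu.1]
        exact hmono t ht (mul_nonneg hr hu0) (mul_nonneg hs hu0)
          (mul_le_mul_of_nonneg_right hrs.le hu0)
    simp only [hrep r hr t ht, hrep s hs t ht]
    exact add_lt_add_of_le_of_lt h (mul_lt_mul_of_pos_right hrs (Real.exp_pos _))
  · exact hjoint.comp (f := fun t : ℝ => (r, t)) (by fun_prop) fun t ht => ⟨hr.le, ht⟩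
  · have h : (∫ u in (1 : ℝ)..2, β₁ (r * u) t) ≤ ∫ u in (1 : ℝ)..2, β₁ (r * u) s :=
      integral_mono_on one_le_two (hint r hr.le t ht) (hint r hr.le s hs) fun u hu =>
        hanti' _ (mul_nonneg hr.le (by linarith [hu.1])) hs ht hst.le
    simp only [hrep r hr.le t ht, hrep r hr.le s hs]
    exact add_lt_add_of_le_of_lt h
      (mul_lt_mul_of_pos_left (Real.exp_lt_exp.2 (neg_lt_neg hst)) hr)
  · have hlim : Tendsto (fun t => β₁ (r * 2) t + r * Real.exp (-t)) atTop (𝓝 0) := by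
      simpa using (hliminf (r * 2) (by linarith)).add
        (Real.tendsto_exp_neg_atTop_nhds_zero.const_mul r)
    refine tendsto_of_tendsto_of_tendsto_of_le_of_le' tendsto_const_nhds hlim ?_ ?_
    · filter_upwards [eventually_ge_atTop 0] with t ht
      exact (hnn r hr.le t ht).trans (hlower r hr.le t ht)
    · filter_upwards [eventually_ge_atTop 0] with t ht
      exact hupper r hr.le t ht
end

section
/- Fix t₀ ∈ ℝ and a Banach space X. Let ψ₁, ψ₂ ∈ K∞ and V : X → [0,∞) be continuous with ψ₁(‖x‖) ≤ V(x) ≤ ψ₂(‖x‖) for all x ∈ X. Let φ and α be positive definite, χ ∈ K∞, and θ > δ > 0 satisfy ∫_a^{α(a)} ds/φ(s) ≤ θ − δ for every a > 0. Then for every impulse time sequence T ∈ S_θ there exist β of class KL and γ of class K such that: for every u ≥ 0 and every x : [t₀,∞) → X for which y := V∘x is a (T,u)-Lyapunov trajectory for (ω, α, χ) with ω(s) = −φ(s), one has ‖x(t)‖ ≤ β(‖x(t₀)‖, t − t₀) + γ(u) for all t ≥ t₀. Moreover γ can be chosen depending only on φ, α, χ, ψ₁, ψ₂ (not on T ∈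 S_θ). -/
open Set Filter Topology intervalIntegral

/-- A class `K∞` function: class `K` and unbounded. -/
def ClassKinf (γ : ℝ → ℝ) : Prop :=
  ClassK γ ∧ Filter.Tendsto γ Filter.atTop Filter.atTop

/-- A positive definite function. -/
def PosDef (φ : ℝ → ℝ) : Prop :=
  ContinuousOn φ (Set.Ici 0) ∧ φ 0 = 0 ∧ ∀ s > (0:ℝ), 0 < φ s

/-- An impulse time sequence: strictly increasing, starting after `t0` and
tending to infinity (no finite accumulation points). -/
def ImpulseSeq (t0 : ℝ) (T : ℕ → ℝ) : Prop :=
  StrictMono T ∧ t0 < T 0 ∧ Filter.Tendsto T Filter.atTop Filter.atTop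

/-- `y : [t0,∞) → [0,∞)` is a `(T,u)`-Lyapunov trajectory for `(ω, α, χ)`, with
left limits `ym i` at the impulse times `T i`: it is piecewise continuous
(right-continuous at impulse times), differentiable off `T` with
`y' ≤ ω(y)` whenever `y ≥ χ(u)`, and satisfies the jump estimate
`y(T i) ≤ max (α (ym i)) (χ u)`. -/
def LyapTraj (t0 : ℝ) (T : ℕ → ℝ) (u : ℝ) (ω α χ : ℝ → ℝ)
    (y : ℝ → ℝ) (ym : ℕ → ℝ) : Prop :=
  (∀ t ≥ t0, 0 ≤ y t) ∧
  ContinuousOn y (Set.Ico t0 (T 0)) ∧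
  (∀ i, ContinuousOn y (Set.Ico (T i) (T (i+1)))) ∧
  (∀ i, Filter.Tendsto y (nhdsWithin (T i) (Set.Iio (T i))) (nhds (ym i))) ∧
  (∀ t ≥ t0, (∀ i, t ≠ T i) → DifferentiableAt ℝ y t) ∧
  (∀ t ≥ t0, (∀ i, t ≠ T i) → χ u ≤ y t → deriv y t ≤ ω (y t)) ∧
  (∀ i, y (T i) ≤ max (α (ym i)) (χ u))

theorem ClassK.nonneg {f : ℝ → ℝ} (hf : ClassK f) {x : ℝ} (hx : 0 ≤ x) : 0 ≤ f x := by
  have h := hf.2.1.monotoneOn (mem_Ici.2 le_rfl) (mem_Ici.2 hx) hx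
  rwa [hf.2.2] at h

theorem ClassK.comp {f g : ℝ → ℝ} (hf : ClassK f) (hg : ClassK g) :
    ClassK fun x => f (g x) := by
  have hmaps : MapsTo g (Ici 0) (Ici 0) := fun _ hx => hg.nonneg hx
  exact ⟨hf.1.comp hg.1 hmaps, hf.2.1.comp hg.2.1 hmaps, by simp [hg.2.2, hf.2.2]⟩

theorem ClassKinf.comp {f g : ℝ → ℝ} (hf : ClassKinf f) (hg : ClassKinf g) :
    ClassKinf fun x => f (g x) :=
  ⟨hf.1.comp hg.1, hf.2.comp hg.2⟩

/-- A class `K∞` function has a class `K` left inverse. -/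
theorem ClassKinf.exists_leftInverse {f : ℝ → ℝ} (hf : ClassKinf f) :
    ∃ g : ℝ → ℝ, ClassK g ∧ ∀ x ≥ (0 : ℝ), g (f x) = x := by
  obtain ⟨⟨hc, hm, h0⟩, ht⟩ := hf
  -- the extension of `f` by the identity on the negative half-line
  set e : ℝ → ℝ := fun x => f (max x 0) + min x 0 with he
  have epos : ∀ x ≥ (0 : ℝ), e x = f x := fun x hx => by simp [he, hx]
  have eneg : ∀ x ≤ (0 : ℝ), e x = x := fun x hx => by simp [he, hx, h0]
  have econt : Continuous e :=
    (hc.comp_continuous (by fun_prop) fun x => le_max_right x 0).add (by fun_prop)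
  have emono : StrictMono e := by
    intro x y hxy
    have hmax : f (max x 0) ≤ f (max y 0) :=
      hm.monotoneOn (le_max_right x 0) (le_max_right y 0) (max_le_max_right 0 hxy.le)
    rcases le_or_gt 0 x with hx | hx
    · rw [epos x hx, epos y (hx.trans hxy.le)]
      exact hm hx (mem_Ici.2 (hx.trans hxy.le)) hxy
    · have : min x 0 < min y 0 := by
        rw [min_eq_left hx.le]
        exact lt_min hxy hx
      exact add_lt_add_of_le_of_lt hmax this
  have etop : Tendsto e atTop atTop :=
    ht.congr' (by filter_upwards [eventually_ge_atTop 0] with x hx using (epos x hx).symm)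
  have ebot : Tendsto e atBot atBot :=
    tendsto_id.congr' (by
      filter_upwards [eventually_le_atBot 0] with x hx using (eneg x hx).symm)
  let i : ℝ ≃o ℝ := emono.orderIsoOfSurjective e (econt.surjective etop ebot)
  have hi : ∀ x, i.symm (e x) = x := fun x => i.symm_apply_apply x
  refine ⟨i.symm, ⟨i.symm.continuous.continuousOn, i.symm.strictMono.strictMonoOn _, ?_⟩, ?_⟩
  · simpa [eneg 0 le_rfl] using hi 0
  · intro x hx
    rw [← epos x hx]
    exact hi x

/-- Composing class `K` functions with an exponential decay yields a class `KL` function. -/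
theorem ClassKL.of_exp_decay {q p : ℝ → ℝ} (hq : ClassK q) (hp : ClassK p) {κ C : ℝ}
    (hκ : 0 < κ) (hC : 0 < C) :
    ClassKL fun r t => q (p r * (C * Real.exp (-(κ * t)))) := by
  have hfac : ∀ t, 0 < C * Real.exp (-(κ * t)) := fun t => by positivity
  have hppos : ∀ r > (0 : ℝ), 0 < p r := fun r hr => by
    simpa [hp.2.2] using hp.2.1 (mem_Ici.2 le_rfl) (mem_Ici.2 hr.le) hr
  refine ⟨?_, ?_, ?_⟩
  · refine hq.1.comp (ContinuousOn.mul (hp.1.comp continuousOn_fst fun x hx => hx.1) ?_) ?_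
    · fun_prop
    · exact fun x hx => mul_nonneg (hp.nonneg hx.1) (hfac _).le
  · intro t _
    refine hq.comp (g := fun r => p r * (C * Real.exp (-(κ * t)))) ⟨?_, ?_, ?_⟩
    · exact hp.1.mul continuousOn_const
    · exact fun a ha b hb hab => mul_lt_mul_of_pos_right (hp.2.1 ha hb hab) (hfac t)
    · simp [hp.2.2]
  · intro r hr
    have hmaps : ∀ t, 0 ≤ p r * (C * Real.exp (-(κ * t))) :=
      fun t => (mul_pos (hppos r hr) (hfac t)).le
    refine ⟨?_, ?_, ?_⟩
    · exact hq.1.comp (by fun_prop) fun t _ => hmaps t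
    · intro a _ b _ hab
      refine hq.2.1 (hmaps b) (hmaps a) ?_
      have : Real.exp (-(κ * b)) < Real.exp (-(κ * a)) :=
        Real.exp_lt_exp.2 (neg_lt_neg (mul_lt_mul_of_pos_left hab hκ))
      exact mul_lt_mul_of_pos_left (mul_lt_mul_of_pos_left this hC) (hppos r hr)
    · have hexp : Tendsto (fun t => Real.exp (-(κ * t))) atTop (𝓝 0) :=
        Real.tendsto_exp_neg_atTop_nhds_zero.comp (tendsto_id.const_mul_atTop hκ)
      have harg : Tendsto (fun t => p r * (C * Real.exp (-(κ * t)))) atTop (𝓝[Ici 0] 0) := by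
        refine tendsto_nhdsWithin_iff.2 ⟨?_, Eventually.of_forall hmaps⟩
        simpa using (hexp.const_mul C).const_mul (p r)
      have hq0 : Tendsto q (𝓝[Ici 0] 0) (𝓝 0) := by
        simpa [ContinuousWithinAt, hq.2.2] using hq.1 0 (mem_Ici.2 le_rfl)
      exact hq0.comp harg

/-- A positive definite function is dominated, uniformly on `[0, r]`, by a class `K` function
that lies above the identity. -/
theorem PosDef.exists_classK_majorant {α : ℝ → ℝ} (hα : PosDef α) :
    ∃ ρ : ℝ → ℝ, ClassK ρ ∧ (∀ r ≥ (0 : ℝ), r ≤ ρ r) ∧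
      ∀ r, ∀ s ∈ Icc 0 r, α s ≤ ρ r := by
  obtain ⟨hc, h0, hpos⟩ := hα
  have hnn : ∀ s ≥ (0 : ℝ), 0 ≤ α s := fun s hs => by
    rcases hs.eq_or_lt with h | h
    · rw [← h, h0]
    · exact (hpos s h).le
  let f : ℝ → ℝ → ℝ := fun r s => α (max (r * s) 0)
  have hf : Continuous (Function.uncurry f) :=
    hc.comp_continuous (f := fun p : ℝ × ℝ => max (p.1 * p.2) 0) (by fun_prop)
      fun p => mem_Ici.2 (le_max_right (p.1 * p.2) 0)
  let m : ℝ → ℝ := fun r => sSup (f r '' Icc 0 1)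
  have hm : Continuous m := isCompact_Icc.continuous_sSup hf
  have hbdd : ∀ r, BddAbove (f r '' Icc 0 1) := fun r =>
    isCompact_Icc.bddAbove_image (hf.comp (by fun_prop : Continuous fun s => (r, s))).continuousOn
  have hle : ∀ r, ∀ s ∈ Icc 0 r, α s ≤ m r := by
    intro r s ⟨hs0, hsr⟩
    rcases (hs0.trans hsr).eq_or_lt with hr | hr
    · obtain rfl : s = 0 := le_antisymm (hr ▸ hsr) hs0
      exact le_csSup (hbdd r) ⟨0, by simp, by simp [f]⟩
    · refine le_csSup (hbdd r) ⟨s / r, ⟨by positivity, (div_le_one hr).2 hsr⟩, ?_⟩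
      simp [f, mul_div_cancel₀ s hr.ne', hs0]
  have hmnn : ∀ r ≥ (0 : ℝ), 0 ≤ m r := fun r hr => h0 ▸ hle r 0 ⟨le_rfl, hr⟩
  have hmono : ∀ a ≥ (0 : ℝ), ∀ b, a ≤ b → m a ≤ m b := by
    intro a ha b hab
    refine csSup_le (Nonempty.image _ ⟨0, by simp⟩) ?_
    rintro _ ⟨s, ⟨hs0, hs1⟩, rfl⟩
    refine hle b _ ⟨le_max_right _ _, max_le ?_ (ha.trans hab)⟩
    exact (mul_le_of_le_one_right ha hs1).trans hab
  have hm0 : m 0 = 0 := by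
    have : f 0 = fun _ => 0 := by
      funext s
      simp [f, h0]
    simp [m, this]
  refine ⟨fun r => r + m r, ⟨?_, ?_, by simp [hm0]⟩, ?_, ?_⟩
  · exact (continuous_id.add hm).continuousOn
  · exact fun a ha b _ hab => add_lt_add_of_lt_of_le hab (hmono a ha b hab.le)
  · exact fun r hr => le_add_of_nonneg_right (hmnn r hr)
  · exact fun r s hs => (hle r s hs).trans (le_add_of_nonneg_left (hs.1.trans hs.2))

theorem PosDef.intervalIntegrable_inv {φ : ℝ → ℝ} (hφ : PosDef φ) {a b : ℝ}
    (ha : 0 < a) (hb : 0 < b) :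
    IntervalIntegrable (fun s => 1 / φ s) MeasureTheory.volume a b := by
  have hsub : ∀ s ∈ uIcc a b, 0 < s := fun s hs => (lt_min ha hb).trans_le hs.1
  refine ContinuousOn.intervalIntegrable (continuousOn_const.div (hφ.1.mono ?_) ?_)
  · exact fun s hs => (hsub s hs).le
  · exact fun s hs => ne_of_gt (hφ.2.2 s (hsub s hs))

/-- The time needed by the flow `y' = -φ(y)` to descend from `w` to `1`. -/
noncomputable def descentTime (φ : ℝ → ℝ) (w : ℝ) : ℝ := ∫ s in (1 : ℝ)..w, 1 / φ s

theorem PosDef.hasDerivAt_descentTime {φ : ℝ → ℝ} (hφ : PosDef φ) {w : ℝ} (hw : 0 < w) :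
    HasDerivAt (descentTime φ) (1 / φ w) w := by
  have hcont : ContinuousOn (fun s => 1 / φ s) (Ioi 0) :=
    continuousOn_const.div (hφ.1.mono Ioi_subset_Ici_self) fun s hs => (hφ.2.2 s hs).ne'
  exact integral_hasDerivAt_right (hφ.intervalIntegrable_inv one_pos hw)
    (hcont.stronglyMeasurableAtFilter isOpen_Ioi w hw) (hcont.continuousAt (Ioi_mem_nhds hw))

theorem PosDef.descentTime_sub {φ : ℝ → ℝ} (hφ : PosDef φ) {a b : ℝ} (ha : 0 < a) (hb : 0 < b) :
    descentTime φ b - descentTime φ a = ∫ s in a..b, 1 / φ s :=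
  integral_interval_sub_left (hφ.intervalIntegrable_inv one_pos hb)
    (hφ.intervalIntegrable_inv one_pos ha)

theorem PosDef.strictMonoOn_descentTime {φ : ℝ → ℝ} (hφ : PosDef φ) :
    StrictMonoOn (descentTime φ) (Ioi 0) := by
  refine strictMonoOn_of_deriv_pos (convex_Ioi 0)
    (fun w hw => (hφ.hasDerivAt_descentTime hw).continuousAt.continuousWithinAt) ?_
  intro w hw
  rw [interior_Ioi] at hw
  rw [(hφ.hasDerivAt_descentTime hw).deriv]
  exact one_div_pos.2 (hφ.2.2 w hw)

/-- The function `w ↦ w exp (descentTime φ w)` is of class `K∞`, whether or not `1 / φ` is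
integrable near `0` or `∞`. -/
theorem PosDef.classKinf_mul_exp_descentTime {φ : ℝ → ℝ} (hφ : PosDef φ) :
    ClassKinf fun w => w * Real.exp (descentTime φ w) := by
  have hF1 : descentTime φ 1 = 0 := integral_same
  have hmono := hφ.strictMonoOn_descentTime.monotoneOn
  refine ⟨⟨?_, ?_, by simp⟩, ?_⟩
  · intro w hw
    rcases (mem_Ici.1 hw).eq_or_lt with rfl | hw
    · have hid : Tendsto (fun w : ℝ => w) (𝓝[Ici 0] 0) (𝓝 0) :=
        tendsto_nhdsWithin_of_tendsto_nhds tendsto_id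
      have hev : ∀ᶠ w : ℝ in 𝓝[Ici 0] 0, 0 ≤ w ∧ w ≤ 1 := by
        filter_upwards [self_mem_nhdsWithin,
          mem_nhdsWithin_of_mem_nhds (Iic_mem_nhds (zero_lt_one' ℝ))] with w h1 h2
        exact ⟨h1, h2⟩
      have : Tendsto (fun w => w * Real.exp (descentTime φ w)) (𝓝[Ici 0] 0) (𝓝 0) := by
        refine squeeze_zero' ?_ ?_ hid
        · filter_upwards [hev] with w h
          exact mul_nonneg h.1 (Real.exp_pos _).le
        · filter_upwards [hev] with w h
          rcases h.1.eq_or_lt with rfl | hw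
          · simp
          · refine mul_le_of_le_one_right h.1 (Real.exp_le_one_iff.2 ?_)
            exact hF1 ▸ hmono hw (mem_Ioi.2 one_pos) h.2
      simpa [ContinuousWithinAt] using this
    · exact (continuousAt_id.mul
        (hφ.hasDerivAt_descentTime hw).continuousAt.rexp).continuousWithinAt
  · intro a ha b _ hab
    have hb : 0 < b := (mem_Ici.1 ha).trans_lt hab
    rcases (mem_Ici.1 ha).eq_or_lt with rfl | ha
    · simpa using mul_pos hb (Real.exp_pos _)
    · exact mul_lt_mul hab (Real.exp_le_exp.2 (hmono ha hb hab.le)) (Real.exp_pos _) hb.le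
  · refine tendsto_atTop_mono' _ ?_ tendsto_id
    filter_upwards [eventually_ge_atTop 1] with w hw
    have hw0 : 0 < w := one_pos.trans_le hw
    refine le_mul_of_one_le_right hw0.le (Real.one_le_exp ?_)
    exact hF1 ▸ hmono (mem_Ioi.2 one_pos) (mem_Ioi.2 hw0) hw

/-- Along a flow with `y' ≤ -φ(y)` above the level `c`, either the level is reached or the
descent time drops at least at unit rate. -/
theorem PosDef.le_or_descentTime_le_of_flow {φ : ℝ → ℝ} (hφ : PosDef φ) {y : ℝ → ℝ}
    {a t c : ℝ} (hc : 0 ≤ c) (hat : a ≤ t) (hcont : ContinuousOn y (Icc a t))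
    (hdiff : ∀ s ∈ Ioo a t, DifferentiableAt ℝ y s)
    (hderiv : ∀ s ∈ Ioo a t, c ≤ y s → deriv y s ≤ -φ (y s)) :
    y t ≤ c ∨ c < y a ∧ descentTime φ (y t) ≤ descentTime φ (y a) - (t - a) := by
  refine or_iff_not_imp_left.2 fun hyt => ?_
  rw [not_le] at hyt
  have habove : ∀ s ∈ Icc a t, c < y s := by
    by_contra! hex
    obtain ⟨s₀, hs₀, hys₀⟩ := hex
    -- `s` is the last time at which the level is not exceeded
    have hcomp : IsCompact (Icc a t ∩ y ⁻¹' Iic c) :=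
      isCompact_Icc.of_isClosed_subset
        (hcont.preimage_isClosed_of_isClosed isClosed_Icc isClosed_Iic) inter_subset_left
    obtain ⟨s, ⟨hs, hys⟩, hmax⟩ := hcomp.exists_isGreatest ⟨s₀, hs₀, hys₀⟩
    have hanti : AntitoneOn y (Icc s t) := by
      have hmem : ∀ r ∈ interior (Icc s t), r ∈ Ioo a t ∧ s < r := fun r hr => by
        rw [interior_Icc] at hr
        exact ⟨⟨hs.1.trans_lt hr.1, hr.2⟩, hr.1⟩
      refine antitoneOn_of_deriv_nonpos (convex_Icc s t)
        (hcont.mono (Icc_subset_Icc_left hs.1))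
        (fun r hr => (hdiff r (hmem r hr).1).differentiableWithinAt) fun r hr => ?_
      obtain ⟨hr, hsr⟩ := hmem r hr
      have hcr : c < y r := by
        by_contra! hle
        exact absurd (hmax ⟨Ioo_subset_Icc_self hr, hle⟩) hsr.not_ge
      exact (hderiv r hr hcr.le).trans (neg_nonpos.2 (hφ.2.2 _ (hc.trans_lt hcr)).le)
    have := hanti (left_mem_Icc.2 hs.2) (right_mem_Icc.2 hs.2) hs.2
    exact absurd (this.trans hys) hyt.not_ge
  have hpos : ∀ s ∈ Icc a t, 0 < y s := fun s hs => hc.trans_lt (habove s hs)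
  refine ⟨habove a (left_mem_Icc.2 hat), ?_⟩
  have hD : ∀ s ∈ Ioo a t, HasDerivAt (fun s => descentTime φ (y s) + s)
      (1 / φ (y s) * deriv y s + 1) s := fun s hs =>
    ((hφ.hasDerivAt_descentTime (hpos s (Ioo_subset_Icc_self hs))).comp s
      (hdiff s hs).hasDerivAt).add (hasDerivAt_id s)
  have hanti : AntitoneOn (fun s => descentTime φ (y s) + s) (Icc a t) := by
    refine antitoneOn_of_deriv_nonpos (convex_Icc a t) ?_ ?_ ?_
    · refine ContinuousOn.add (fun s hs => ?_) continuousOn_id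
      exact (hφ.hasDerivAt_descentTime (hpos s hs)).continuousAt.comp_continuousWithinAt
        (hcont s hs)
    · intro s hs
      rw [interior_Icc] at hs
      exact (hD s hs).differentiableAt.differentiableWithinAt
    · intro s hs
      rw [interior_Icc] at hs
      have hs' := Ioo_subset_Icc_self hs
      have hφs : 0 < φ (y s) := hφ.2.2 _ (hpos s hs')
      rw [(hD s hs).deriv, one_div_mul_eq_div, ← le_neg_iff_add_nonpos_right, div_le_iff₀ hφs]
      linarith [hderiv s hs (habove s hs').le]
  have := hanti (left_mem_Icc.2 hat) (right_mem_Icc.2 hat) hat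
  simp only at this
  linarith

/-- The estimate along a flow passes to the left limit at the end of the flow interval. -/
theorem PosDef.le_or_descentTime_le_of_leftLimit {φ : ℝ → ℝ} (hφ : PosDef φ) {y : ℝ → ℝ}
    {a b c l : ℝ} (hc : 0 ≤ c) (hab : a < b) (hl : Tendsto y (𝓝[<] b) (𝓝 l))
    (hflow : ∀ t ∈ Ico a b,
      y t ≤ c ∨ c < y a ∧ descentTime φ (y t) ≤ descentTime φ (y a) - (t - a)) :
    l ≤ c ∨ c < y a ∧ descentTime φ l ≤ descentTime φ (y a) - (b - a) := by
  refine or_iff_not_imp_left.2 fun hcl => ?_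
  rw [not_le] at hcl
  have hev : ∀ᶠ t in 𝓝[<] b,
      c < y a ∧ descentTime φ (y t) ≤ descentTime φ (y a) - (t - a) := by
    filter_upwards [hl.eventually_const_lt hcl, Ico_mem_nhdsLT hab] with t ht htab
    exact (hflow t htab).resolve_left ht.not_ge
  refine ⟨hev.exists.choose_spec.1, ?_⟩
  have hF := (hφ.hasDerivAt_descentTime (hc.trans_lt hcl)).continuousAt.tendsto.comp hl
  have hid : Tendsto (fun t : ℝ => descentTime φ (y a) - (t - a)) (𝓝[<] b)
      (𝓝 (descentTime φ (y a) - (b - a))) :=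
    tendsto_nhdsWithin_of_tendsto_nhds
      (by fun_prop : Continuous fun t : ℝ => descentTime φ (y a) - (t - a)).continuousAt
  exact le_of_tendsto_of_tendsto hF hid (hev.mono fun t ht => ht.2)

/-- Decay estimate for scalar Lyapunov trajectories under the dwell-time condition: either the
trajectory is below the gain level, or its descent time has decreased linearly since the first
impulse. -/
theorem LyapTraj.le_or_descentTime_le {t0 : ℝ} {T : ℕ → ℝ} {u : ℝ} {φ α χ y : ℝ → ℝ}
    {ym : ℕ → ℝ} {θ δ : ℝ} {ρ : ℝ → ℝ} (hφ : PosDef φ) (hα : PosDef α) (hδ : 0 < δ) (hθ : δ < θ)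
    (hFDT : ∀ a > (0 : ℝ), (∫ s in a..(α a), 1 / φ s) ≤ θ - δ)
    (hρid : ∀ r ≥ (0 : ℝ), r ≤ ρ r) (hρα : ∀ r, ∀ s ∈ Icc 0 r, α s ≤ ρ r)
    (hc : 0 ≤ χ u) (hT : ImpulseSeq t0 T) (hdwell : ∀ i, θ ≤ T (i + 1) - T i)
    (hy : LyapTraj t0 T u (fun s => -φ s) α χ y ym) {t : ℝ} (ht : t0 ≤ t) :
    y t ≤ ρ (χ u) ∨ 0 < y t ∧ y t ≤ ρ (y t0) ∧
      descentTime φ (y t) ≤ descentTime φ (ρ (y t0)) - δ / θ * (t - T 0) := by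
  obtain ⟨hTmono, hT0, hTtop⟩ := hT
  obtain ⟨hnn, hcont0, hconti, hlim, hdiff, hderiv, hjump⟩ := hy
  set c := χ u
  set F := descentTime φ
  have hθ0 : 0 < θ := hδ.trans hθ
  have hκ : 0 < δ / θ := div_pos hδ hθ0
  have hκ1 : δ / θ < 1 := (div_lt_one hθ0).2 hθ
  have hcρ : c ≤ ρ c := hρid c hc
  have hr : 0 ≤ y t0 := hnn t0 le_rfl
  have hFle : ∀ {a b : ℝ}, 0 < a → 0 < b → F a ≤ F b → a ≤ b := fun ha hb h =>
    (hφ.strictMonoOn_descentTime.le_iff_le ha hb).1 h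
  have hFmono : ∀ {a b : ℝ}, 0 < a → a ≤ b → F a ≤ F b := fun ha h =>
    hφ.strictMonoOn_descentTime.monotoneOn ha (mem_Ioi.2 (ha.trans_le h)) h
  have hTt0 : ∀ i, t0 < T i := fun i => hT0.trans_le (hTmono.monotone i.zero_le)
  have hflow0 : ∀ s ∈ Ico t0 (T 0), y s ≤ c ∨ c < y t0 ∧ F (y s) ≤ F (y t0) - (s - t0) := by
    intro s hs
    have hoff : ∀ r ∈ Ioo t0 s, ∀ i, r ≠ T i := fun r hr i h =>
      absurd (hTmono.monotone i.zero_le) (not_le.2 (h ▸ hr.2.trans hs.2))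
    exact hφ.le_or_descentTime_le_of_flow hc hs.1
      (hcont0.mono fun r hr => ⟨hr.1, hr.2.trans_lt hs.2⟩)
      (fun r hr => hdiff r hr.1.le (hoff r hr)) fun r hr => hderiv r hr.1.le (hoff r hr)
  have hflow : ∀ i, ∀ s ∈ Ico (T i) (T (i + 1)),
      y s ≤ c ∨ c < y (T i) ∧ F (y s) ≤ F (y (T i)) - (s - T i) := by
    intro i s hs
    have hoff : ∀ r ∈ Ioo (T i) s, ∀ j, r ≠ T j := by
      rintro r hr j rfl
      have h1 : i < j := hTmono.lt_iff_lt.1 hr.1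
      have h2 : j < i + 1 := hTmono.lt_iff_lt.1 (hr.2.trans hs.2)
      omega
    have hge : ∀ r ∈ Ioo (T i) s, t0 ≤ r := fun r hr => (hTt0 i).le.trans hr.1.le
    exact hφ.le_or_descentTime_le_of_flow hc hs.1
      ((hconti i).mono fun r hr => ⟨hr.1, hr.2.trans_lt hs.2⟩)
      (fun r hr => hdiff r (hge r hr) (hoff r hr))
      fun r hr => hderiv r (hge r hr) (hoff r hr)
  have hym : ∀ i, 0 ≤ ym i := fun i => by
    refine ge_of_tendsto (hlim i) ?_
    filter_upwards [Ico_mem_nhdsLT (hTt0 i)] with s hs using hnn s hs.1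
  -- a jump from below the level `c` stays below `ρ c`
  have hlow : ∀ i, ym i ≤ c → y (T i) ≤ ρ c := fun i h =>
    (hjump i).trans (max_le (hρα c _ ⟨hym i, h⟩) hcρ)
  have hstart : y (T 0) ≤ ρ c ∨ 0 < y t0 ∧ y (T 0) ≤ ρ (y t0) := by
    rcases hφ.le_or_descentTime_le_of_leftLimit hc hT0 (hlim 0) hflow0 with h | ⟨hcr, h⟩
    · exact Or.inl (hlow 0 h)
    · rcases le_or_gt (ym 0) c with hle | hgt
      · exact Or.inl (hlow 0 hle)
      have hr0 : 0 < y t0 := hc.trans_lt hcr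
      have hymr : ym 0 ≤ y t0 := hFle (hc.trans_lt hgt) hr0 (h.trans (by linarith))
      rcases le_max_iff.1 (hjump 0) with h' | h'
      · exact Or.inr ⟨hr0, h'.trans (hρα _ _ ⟨hym 0, hymr⟩)⟩
      · exact Or.inl (h'.trans hcρ)
  have hstep : ∀ i, y (T (i + 1)) ≤ ρ c ∨ c < y (T i) ∧
      F (y (T (i + 1))) ≤ F (y (T i)) - δ / θ * (T (i + 1) - T i) := by
    intro i
    rcases le_or_gt (y (T (i + 1))) (ρ c) with hle | hgt
    · exact Or.inl hle
    refine Or.inr ?_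
    have hgtym : c < ym (i + 1) := by
      by_contra! h
      exact absurd (hlow _ h) hgt.not_ge
    obtain ⟨hci, h⟩ := (hφ.le_or_descentTime_le_of_leftLimit hc
      (hTmono i.lt_succ_self) (hlim (i + 1)) (hflow i)).resolve_left hgtym.not_ge
    refine ⟨hci, ?_⟩
    have hym0 : 0 < ym (i + 1) := hc.trans_lt hgtym
    have hα' : y (T (i + 1)) ≤ α (ym (i + 1)) :=
      (le_max_iff.1 (hjump (i + 1))).resolve_right (hcρ.trans_lt hgt).not_ge
    have h1 : F (y (T (i + 1))) ≤ F (α (ym (i + 1))) :=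
      hFmono (hc.trans_lt (hcρ.trans_lt hgt)) hα'
    have h2 : F (α (ym (i + 1))) - F (ym (i + 1)) ≤ θ - δ :=
      (hφ.descentTime_sub hym0 (hα.2.2 _ hym0)).trans_le (hFDT _ hym0)
    have h3 : (1 - δ / θ) * θ ≤ (1 - δ / θ) * (T (i + 1) - T i) :=
      mul_le_mul_of_nonneg_left (hdwell i) (sub_nonneg.2 hκ1.le)
    have h4 : (1 - δ / θ) * θ = θ - δ := by field_simp
    linarith
  have himp : ∀ i, y (T i) ≤ ρ c ∨ 0 < y t0 ∧
      F (y (T i)) ≤ F (ρ (y t0)) - δ / θ * (T i - T 0) := by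
    intro i
    induction i with
    | zero =>
      rcases hstart with h | ⟨hr0, h⟩
      · exact Or.inl h
      · rcases le_or_gt (y (T 0)) (ρ c) with hle | hgt
        · exact Or.inl hle
        · exact Or.inr ⟨hr0, by simpa using hFmono (hc.trans_lt (hcρ.trans_lt hgt)) h⟩
    | succ i ih =>
      rcases le_or_gt (y (T (i + 1))) (ρ c) with hle | hgt
      · exact Or.inl hle
      obtain ⟨hci, h⟩ := (hstep i).resolve_left hgt.not_ge
      rcases ih with ih | ⟨hr0, ih⟩
      · refine Or.inl ((hFle (hc.trans_lt (hcρ.trans_lt hgt)) (hc.trans_lt hci) ?_).trans ih)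
        have := mul_pos hκ (sub_pos.2 (hTmono i.lt_succ_self))
        exact h.trans (by simpa using this.le)
      · exact Or.inr ⟨hr0, by linarith⟩
  rcases le_or_gt (y t) (ρ c) with hle | hgt
  · exact Or.inl hle
  have hct : c < y t := hcρ.trans_lt hgt
  have hyt : 0 < y t := hc.trans_lt hct
  refine Or.inr ⟨hyt, ?_⟩
  rcases lt_or_ge t (T 0) with htT | htT
  · obtain ⟨hcr, h⟩ := (hflow0 t ⟨ht, htT⟩).resolve_left hct.not_ge
    have hr0 : 0 < y t0 := hc.trans_lt hcr
    have hle : y t ≤ y t0 := hFle hyt hr0 (h.trans (by linarith))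
    refine ⟨hle.trans (hρid _ hr), (hFmono hyt (hle.trans (hρid _ hr))).trans ?_⟩
    nlinarith
  · obtain ⟨i, hi⟩ : ∃ i, t ∈ Ico (T i) (T (i + 1)) := by
      have hex : ∃ n, t < T n := (hTtop.eventually_gt_atTop t).exists
      classical
      obtain ⟨i, hi⟩ : ∃ i, Nat.find hex = i + 1 := Nat.exists_eq_succ_of_ne_zero fun h =>
        absurd (h ▸ Nat.find_spec hex) htT.not_gt
      exact ⟨i, not_lt.1 (Nat.find_min hex (by omega)), hi ▸ Nat.find_spec hex⟩
    obtain ⟨hci, h⟩ := (hflow i t hi).resolve_left hct.not_ge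
    have hti : 0 ≤ t - T i := sub_nonneg.2 hi.1
    rcases himp i with h' | ⟨hr0, h'⟩
    · have := hFle hyt (hc.trans_lt hci) (h.trans (by linarith))
      exact absurd (this.trans h') hgt.not_ge
    · have hdec : F (y t) ≤ F (ρ (y t0)) - δ / θ * (t - T 0) := by
        nlinarith
      refine ⟨hFle hyt (hr0.trans_le (hρid _ hr)) (hdec.trans ?_), hdec⟩
      exact sub_le_self _ (mul_nonneg hκ.le (sub_nonneg.2 htT))

/-- ISS over the fixed dwell-time class `S_θ` for systems with an
ISS-Lyapunov function, under the nonlinear FDT condition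
`∫_a^{α(a)} ds/φ(s) ≤ θ - δ`; the gain `γ` is independent of `T ∈ S_θ`. -/
theorem stmt_5 {X : Type*} [NormedAddCommGroup X]
    (t0 : ℝ) (ψ₁ ψ₂ : ℝ → ℝ) (hψ₁ : ClassKinf ψ₁) (hψ₂ : ClassKinf ψ₂)
    (V : X → ℝ) (hVc : Continuous V) (hVnn : ∀ x, 0 ≤ V x)
    (hVlow : ∀ x : X, ψ₁ ‖x‖ ≤ V x) (hVup : ∀ x : X, V x ≤ ψ₂ ‖x‖)
    (φ α : ℝ → ℝ) (hφ : PosDef φ) (hα : PosDef α)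
    (χ : ℝ → ℝ) (hχ : ClassKinf χ)
    (θ δ : ℝ) (hδ : 0 < δ) (hθ : δ < θ)
    (hFDT : ∀ a > (0:ℝ), (∫ s in a..(α a), 1 / φ s) ≤ θ - δ) :
    ∃ γ : ℝ → ℝ, ClassK γ ∧
      ∀ T : ℕ → ℝ, ImpulseSeq t0 T → (∀ i, θ ≤ T (i+1) - T i) →
        ∃ β : ℝ → ℝ → ℝ, ClassKL β ∧
          ∀ u ≥ (0:ℝ), ∀ x : ℝ → X, ∀ ym : ℕ → ℝ,
            LyapTraj t0 T u (fun s => -φ s) α χ (fun t => V (x t)) ym →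
            ∀ t ≥ t0, ‖x t‖ ≤ β ‖x t0‖ (t - t0) + γ u := by
  obtain ⟨ρ, hρ, hρid, hρα⟩ := hα.exists_classK_majorant
  obtain ⟨g, hg, hgψ⟩ := hψ₁.exists_leftInverse
  have hE := hφ.classKinf_mul_exp_descentTime
  obtain ⟨q, hq, hqE⟩ := (hE.comp hψ₁).exists_leftInverse
  have hθ0 : 0 < θ := hδ.trans hθ
  have hγ : ClassK fun u => g (ρ (χ u)) := hg.comp (hρ.comp hχ.1)
  refine ⟨_, hγ, fun T hT hdwell => ?_⟩
  have hβ := ClassKL.of_exp_decay hq (hE.1.comp (hρ.comp hψ₂.1)) (div_pos hδ hθ0)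
    (Real.exp_pos (δ / θ * (T 0 - t0)))
  refine ⟨_, hβ, fun u hu x ym hy t ht => ?_⟩
  have hxn := norm_nonneg (x t)
  have hx0 := norm_nonneg (x t0)
  have hψx := hψ₁.1.nonneg hxn
  have hβ0 := (hβ.2.1 (t - t0) (sub_nonneg.2 ht)).nonneg hx0
  have hγ0 := hγ.nonneg hu
  rcases hy.le_or_descentTime_le hφ hα hδ hθ hFDT hρid hρα (hχ.1.nonneg hu) hT hdwell ht with
    h | ⟨hpos, hle, hdec⟩
  · have : g (ψ₁ ‖x t‖) ≤ g (ρ (χ u)) :=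
      hg.2.1.monotoneOn hψx (hρ.nonneg (hχ.1.nonneg hu)) ((hVlow _).trans h)
    rw [hgψ _ hxn] at this
    exact this.trans (le_add_of_nonneg_left hβ0)
  · refine le_trans ?_ (le_add_of_nonneg_right hγ0)
    have hρV : 0 ≤ ρ (V (x t0)) := hρ.nonneg (hVnn _)
    have hEψ : ψ₁ ‖x t‖ * Real.exp (descentTime φ (ψ₁ ‖x t‖)) ≤
        ρ (ψ₂ ‖x t0‖) * Real.exp (descentTime φ (ρ (ψ₂ ‖x t0‖))) *
          (Real.exp (δ / θ * (T 0 - t0)) * Real.exp (-(δ / θ * (t - t0)))) := by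
      calc _ ≤ V (x t) * Real.exp (descentTime φ (V (x t))) :=
            hE.1.2.1.monotoneOn hψx (hVnn _) (hVlow _)
        _ ≤ ρ (V (x t0)) *
              Real.exp (descentTime φ (ρ (V (x t0))) - δ / θ * (t - T 0)) :=
            mul_le_mul hle (Real.exp_le_exp.2 hdec) (Real.exp_pos _).le hρV
        _ = ρ (V (x t0)) * Real.exp (descentTime φ (ρ (V (x t0)))) *
              (Real.exp (δ / θ * (T 0 - t0)) * Real.exp (-(δ / θ * (t - t0)))) := by
            rw [← Real.exp_add, mul_assoc, ← Real.exp_add]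
            ring_nf
        _ ≤ _ := by
            refine mul_le_mul_of_nonneg_right ?_ (by positivity)
            exact (hE.1.comp hρ).2.1.monotoneOn (hVnn _) (hψ₂.1.nonneg hx0) (hVup _)
    have := hq.2.1.monotoneOn (hE.1.nonneg hψx) ((hE.1.nonneg hψx).trans hEψ) hEψ
    rwa [hqE _ hxn] at this
end

section
/- Fix t₀ ∈ ℝ and a Banach space X. Let ψ₁, ψ₂ ∈ K∞ and V : X → [0,∞) be continuous with ψ₁(‖x‖) ≤ V(x) ≤ ψ₂(‖x‖) for all x ∈ X. Let ψ be positive definite with ∫_1^∞ ds/ψ(s) = ∞, let α be positive definite, χ ∈ K∞, and θ, δ > 0 satisfy ∫_{α(a)}^a ds/ψ(s) ≥ θ + δ for every a > 0 (in particular α(a) < a for all a > 0). Then for every impulse time sequence T ∈ S̃_θ there exist β of class KL and γ of class K (γ independent of T ∈ S̃_θ) such that: for every u ≥ 0 and every x : [t₀,∞) → X for which y := V∘x is a (T,u)-Lyapunov trajectory for (ω, α, χ) with ω(s) = ψ(s), one has ‖x(t)‖ ≤ β(‖x(t₀)‖, t − t₀) + γ(u) for all t ≥ t₀. -/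
open Set Filter Topology intervalIntegral

/-- A class `K∞` function has a continuous strictly increasing inverse. -/
lemma ClassKinf.exists_inverse {φ : ℝ → ℝ} (hφ : ClassKinf φ) :
    ∃ g : ℝ → ℝ, Continuous g ∧ StrictMono g ∧ g 0 = 0 ∧ ∀ s, 0 ≤ s → g (φ s) = s := by
  obtain ⟨⟨hc, hm, h0⟩, ht⟩ := hφ
  set f : ℝ → ℝ := fun s => φ (max s 0) + min s 0 with hf
  have hfc : Continuous f := by
    refine Continuous.add ?_ (by fun_prop)
    exact hc.comp_continuous (by fun_prop) fun s => le_max_right s 0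
  have hfm : StrictMono f := by
    intro a b hab
    rcases le_or_gt 0 a with ha | ha
    · have hb := ha.trans hab.le
      simpa [hf, ha, hb] using hm ha hb hab
    · refine add_lt_add_of_le_of_lt (hm.monotoneOn (mem_Ici.2 (le_max_right a 0))
        (mem_Ici.2 (le_max_right b 0)) (max_le_max_right _ hab.le)) ?_
      rw [min_eq_left ha.le]
      exact lt_min hab ha
  have hf_nonneg : ∀ s, 0 ≤ s → f s = φ s := fun s hs => by simp [hf, hs]
  have hfs : Function.Surjective f := by
    refine hfc.surjective ?_ ?_
    · refine ht.congr' ?_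
      filter_upwards [eventually_ge_atTop 0] with s hs using (hf_nonneg s hs).symm
    · refine tendsto_id.congr' ?_
      filter_upwards [eventually_le_atBot 0] with s hs
      simp [hf, hs, h0]
  let e := hfm.orderIsoOfSurjective f hfs
  have he : ∀ s, e.symm (f s) = s := fun s => e.symm_apply_apply s
  refine ⟨e.symm, e.symm.continuous, e.symm.strictMono, ?_, fun s hs => ?_⟩
  · have := he 0
    rwa [hf_nonneg 0 le_rfl, h0] at this
  · rw [← hf_nonneg s hs, he]

/-- `F` is a primitive of `1 / ψ` on `(0,∞)` and `E : ℝ → (0,∞)` is its inverse: in the coordinate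
`F`, the scalar equation `y' = ψ(y)` is motion at unit speed. -/
structure TimeCoordinate (ψ F E : ℝ → ℝ) : Prop where
  hasDerivAt : ∀ q > 0, HasDerivAt F (1 / ψ q) q
  integral_eq : ∀ p > 0, ∀ q > 0, ∫ s in p..q, 1 / ψ s = F q - F p
  strictMono : StrictMono E
  continuous : Continuous E
  tendsto_atBot : Tendsto E atBot (𝓝 0)
  pos : ∀ z, 0 < E z
  apply_inverse : ∀ z, F (E z) = z
  inverse_apply : ∀ q > 0, E (F q) = q

lemma exists_timeCoordinate {ψ α : ℝ → ℝ} (hψ : PosDef ψ)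
    (hψdiv : Tendsto (fun b => ∫ s in (1:ℝ)..b, 1 / ψ s) atTop atTop)
    (hα : PosDef α) {κ : ℝ} (hκ : 0 < κ)
    (hFDT : ∀ a > (0:ℝ), κ ≤ ∫ s in (α a)..a, 1 / ψ s) :
    ∃ F E : ℝ → ℝ, TimeCoordinate ψ F E := by
  obtain ⟨hψc, -, hψpos⟩ := hψ
  have hcont : ContinuousOn (fun s => 1 / ψ s) (Ioi 0) :=
    continuousOn_const.div (hψc.mono Ioi_subset_Ici_self) fun s hs => (hψpos s hs).ne'
  have hint : ∀ p > 0, ∀ q > 0, IntervalIntegrable (fun s => 1 / ψ s) MeasureTheory.volume p q :=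
    fun p hp q hq => (hcont.mono fun s hs => lt_of_lt_of_le (lt_min hp hq) hs.1).intervalIntegrable
  set F : ℝ → ℝ := fun b => ∫ s in (1:ℝ)..b, 1 / ψ s with hF
  have hderiv : ∀ q > 0, HasDerivAt F (1 / ψ q) q := fun q hq =>
    integral_hasDerivAt_right (hint 1 one_pos q hq)
      (hcont.stronglyMeasurableAtFilter isOpen_Ioi q hq) (hcont.continuousAt (Ioi_mem_nhds hq))
  have hsub : ∀ p > 0, ∀ q > 0, ∫ s in p..q, 1 / ψ s = F q - F p := fun p hp q hq =>
    (integral_interval_sub_left (hint 1 one_pos q hq) (hint 1 one_pos p hp)).symm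
  set f : ℝ → ℝ := fun z => F (Real.exp z) with hf
  have hfd : ∀ z, HasDerivAt f (1 / ψ (Real.exp z) * Real.exp z) z := fun z =>
    (hderiv _ (Real.exp_pos z)).comp z (Real.hasDerivAt_exp z)
  have hfm : StrictMono f := by
    refine strictMono_of_deriv_pos fun z => ?_
    rw [(hfd z).deriv]
    have := hψpos _ (Real.exp_pos z)
    positivity
  have hfc : Continuous f := continuous_iff_continuousAt.2 fun z => (hfd z).continuousAt
  have hiter : ∀ n : ℕ, 0 < α^[n] 1 ∧ F (α^[n] 1) ≤ -(n * κ) := by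
    intro n
    induction n with
    | zero => simp [hF]
    | succ n ih =>
      rw [Function.iterate_succ_apply']
      have hpos := hα.2.2 _ ih.1
      refine ⟨hpos, ?_⟩
      have := hFDT _ ih.1
      rw [hsub _ hpos _ ih.1] at this
      push_cast
      linarith [ih.2]
  have hfs : Function.Surjective f := by
    intro z
    refine mem_range_of_exists_le_of_exists_ge hfc ?_ ?_
    · obtain ⟨n, hn⟩ := exists_nat_gt (-z / κ)
      refine ⟨Real.log (α^[n] 1), ?_⟩
      rw [div_lt_iff₀ hκ] at hn
      simp only [hf, Real.exp_log (hiter n).1]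
      linarith [(hiter n).2]
    · exact ((hψdiv.comp Real.tendsto_exp_atTop).eventually_ge_atTop z).exists
  let e := hfm.orderIsoOfSurjective f hfs
  refine ⟨F, fun z => Real.exp (e.symm z), hderiv, hsub, Real.exp_strictMono.comp e.symm.strictMono,
    Real.continuous_exp.comp e.symm.continuous, Real.tendsto_exp_atBot.comp e.symm.tendsto_atBot,
    fun z => Real.exp_pos _, fun z => e.apply_symm_apply z, fun q hq => ?_⟩
  have : e.symm (f (Real.log q)) = Real.log q := e.symm_apply_apply _
  simp only [hf, Real.exp_log hq] at this
  simp only [this, Real.exp_log hq]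

namespace TimeCoordinate

variable {ψ F E : ℝ → ℝ}

lemma le_inverse_iff (h : TimeCoordinate ψ F E) {q z : ℝ} (hq : 0 < q) : q ≤ E z ↔ F q ≤ z := by
  conv_lhs => rw [← h.inverse_apply q hq]
  exact h.strictMono.le_iff_le

lemma inverse_lt_iff (h : TimeCoordinate ψ F E) {q z : ℝ} (hq : 0 < q) : E z < q ↔ z < F q := by
  conv_lhs => rw [← h.inverse_apply q hq]
  exact h.strictMono.lt_iff_lt

lemma strictMonoOn (h : TimeCoordinate ψ F E) : StrictMonoOn F (Ioi 0) := by
  intro p hp q hq hpq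
  rwa [← h.inverse_lt_iff hq, h.inverse_apply p hp]

end TimeCoordinate

/-- The value after time `s` of the solution of `y' = ψ(y)` starting from `r`, extended by `0`
to `r ≤ 0`. -/
noncomputable def timeFlow (F E : ℝ → ℝ) (r s : ℝ) : ℝ := if r ≤ 0 then 0 else E (F r + s)

section timeFlow

variable {ψ F E : ℝ → ℝ}

lemma timeFlow_of_nonpos {r : ℝ} (hr : r ≤ 0) (s : ℝ) : timeFlow F E r s = 0 := if_pos hr

lemma timeFlow_of_pos {r : ℝ} (hr : 0 < r) (s : ℝ) : timeFlow F E r s = E (F r + s) :=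
  if_neg hr.not_ge

lemma timeFlow_nonneg (h : TimeCoordinate ψ F E) (r s : ℝ) : 0 ≤ timeFlow F E r s := by
  rcases le_or_gt r 0 with hr | hr
  · rw [timeFlow_of_nonpos hr]
  · rw [timeFlow_of_pos hr]
    exact (h.pos _).le

lemma timeFlow_strictMonoOn (h : TimeCoordinate ψ F E) (s : ℝ) :
    StrictMonoOn (fun r => timeFlow F E r s) (Ici 0) := by
  intro p hp q _ hpq
  have hq : 0 < q := lt_of_le_of_lt hp hpq
  simp only [timeFlow_of_pos hq]
  rcases eq_or_lt_of_le (mem_Ici.1 hp) with rfl | hp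
  · rw [timeFlow_of_nonpos le_rfl]
    exact h.pos _
  · rw [timeFlow_of_pos hp]
    exact h.strictMono (add_lt_add_left (h.strictMonoOn hp hq hpq) s)

lemma timeFlow_lt (h : TimeCoordinate ψ F E) {r s ε : ℝ} (hε : 0 < ε) (hr : r < E (F ε - s)) :
    timeFlow F E r s < ε := by
  rcases le_or_gt r 0 with hr0 | hr0
  · rwa [timeFlow_of_nonpos hr0]
  · rw [timeFlow_of_pos hr0, h.inverse_lt_iff hε]
    have := h.strictMonoOn hr0 (h.pos _) hr
    rw [h.apply_inverse] at this
    linarith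

lemma continuous_timeFlow (h : TimeCoordinate ψ F E) :
    Continuous fun p : ℝ × ℝ => timeFlow F E p.1 p.2 := by
  refine continuous_iff_continuousAt.2 ?_
  rintro ⟨r, s⟩
  rcases lt_or_ge 0 r with hr | hr
  · have hc : ContinuousAt (fun p : ℝ × ℝ => E (F p.1 + p.2)) (r, s) := by
      refine h.continuous.continuousAt.comp (ContinuousAt.add ?_ continuousAt_snd)
      exact ContinuousAt.comp (x := ((r, s) : ℝ × ℝ)) (f := Prod.fst)
        (h.hasDerivAt r hr).continuousAt continuousAt_fst
    refine hc.congr ?_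
    filter_upwards [continuousAt_fst.eventually (lt_mem_nhds hr)] with p hp
    exact (timeFlow_of_pos hp _).symm
  · rw [ContinuousAt, timeFlow_of_nonpos hr, Metric.tendsto_nhds]
    intro ε hε
    have hr' : r < E (F ε - (s + 1)) := hr.trans_lt (h.pos _)
    filter_upwards [continuousAt_fst.eventually (gt_mem_nhds hr'),
      continuousAt_snd.eventually (gt_mem_nhds (lt_add_one s))] with p hp₁ hp₂
    rw [Real.dist_eq, sub_zero, abs_of_nonneg (timeFlow_nonneg h _ _)]
    refine timeFlow_lt h hε (lt_of_lt_of_le hp₁ (h.strictMono.monotone ?_))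
    linarith

/-- Comparison principle: above a level `m`, a subsolution of `y' = ψ(y)` starting below `m`
stays below the solution starting from `m`. -/
lemma le_inverse_of_deriv_le (h : TimeCoordinate ψ F E) (hψpos : ∀ s > 0, 0 < ψ s)
    {y : ℝ → ℝ} {a b m : ℝ} (hm : 0 < m) (hyc : ContinuousOn y (Ico a b))
    (hyd : ∀ t ∈ Ioo a b, DifferentiableAt ℝ y t)
    (hy : ∀ t ∈ Ioo a b, m ≤ y t → deriv y t ≤ ψ (y t)) (hya : y a ≤ m) :
    ∀ t ∈ Ico a b, y t ≤ E (F m + (t - a)) := by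
  intro t ht
  rcases le_or_gt (y t) m with hyt | hyt
  · refine hyt.trans ((h.le_inverse_iff hm).2 ?_)
    linarith [ht.1]
  have hsub : Icc a t ⊆ Ico a b := fun s hs => ⟨hs.1, hs.2.trans_lt ht.2⟩
  have hcl : IsClosed (Icc a t ∩ y ⁻¹' Iic m) :=
    (hyc.mono hsub).preimage_isClosed_of_isClosed isClosed_Icc isClosed_Iic
  obtain ⟨s, ⟨hs, hysm⟩, hmax⟩ := (isCompact_Icc.of_isClosed_subset hcl inter_subset_left
    ).exists_isGreatest ⟨a, ⟨le_rfl, ht.1⟩, hya⟩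
  have hst : s < t := lt_of_le_of_ne hs.2 (by rintro rfl; exact hyt.not_ge hysm)
  have hgt : ∀ τ ∈ Ioc s t, m < y τ := fun τ hτ => by
    by_contra hle
    exact hτ.1.not_ge (hmax ⟨⟨hs.1.trans hτ.1.le, hτ.2⟩, not_lt.1 hle⟩)
  have hsubs : Icc s t ⊆ Icc a t := Icc_subset_Icc_left hs.1
  have hys : y s = m := by
    refine le_antisymm hysm ?_
    have hlim : Tendsto y (𝓝[>] s) (𝓝 (y s)) :=
      ((hyc.mono (hsubs.trans hsub)) s ⟨le_rfl, hst.le⟩).mono_left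
        ((nhdsWithin_Ioc_eq_nhdsGT hst).symm.le.trans (nhdsWithin_mono _ Ioc_subset_Icc_self))
    refine ge_of_tendsto hlim ?_
    filter_upwards [Ioc_mem_nhdsGT hst] with τ hτ using (hgt τ hτ).le
  have hypos : ∀ τ ∈ Icc s t, 0 < y τ := fun τ hτ => by
    rcases eq_or_lt_of_le hτ.1 with rfl | hlt
    · rwa [hys]
    · exact hm.trans (hgt τ ⟨hlt, hτ.2⟩)
  have hFy : ∀ τ ∈ Ioo s t, HasDerivAt (fun τ => F (y τ)) (1 / ψ (y τ) * deriv y τ) τ :=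
    fun τ hτ => (h.hasDerivAt _ (hypos τ ⟨hτ.1.le, hτ.2.le⟩)).comp τ
      (hyd τ ⟨hs.1.trans_lt hτ.1, hτ.2.trans ht.2⟩).hasDerivAt
  have hmvt := (convex_Icc s t).image_sub_le_mul_sub_of_deriv_le (f := fun τ => F (y τ)) (C := 1)
    (fun τ hτ => (h.hasDerivAt _ (hypos τ hτ)).continuousAt.comp_continuousWithinAt
      (hyc.mono (hsubs.trans hsub) τ hτ))
    (fun τ hτ => by
      rw [interior_Icc] at hτ
      exact (hFy τ hτ).differentiableAt.differentiableWithinAt)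
    (fun τ hτ => by
      rw [interior_Icc] at hτ
      rw [(hFy τ hτ).deriv, one_div_mul_eq_div,
        div_le_one (hψpos _ (hypos τ ⟨hτ.1.le, hτ.2.le⟩))]
      exact hy τ ⟨hs.1.trans_lt hτ.1, hτ.2.trans ht.2⟩ (hgt τ ⟨hτ.1, hτ.2.le⟩).le)
    s ⟨le_rfl, hst.le⟩ t ⟨hst.le, le_rfl⟩ hst.le
  simp only [hys] at hmvt
  rw [h.le_inverse_iff (hm.trans hyt)]
  linarith [hs.1]

/-- One flow period of length at most `θ` followed by a jump lowers the coordinate `F` by `δ`, down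
to the level `c`. -/
lemma jump_le (h : TimeCoordinate ψ F E) {α : ℝ → ℝ} (hα : PosDef α) {θ δ : ℝ}
    (hFDT : ∀ a > (0:ℝ), θ + δ ≤ ∫ s in (α a)..a, 1 / ψ s) {y : ℝ → ℝ} {a b z yb : ℝ}
    (hab : a < b) (hbaθ : b - a ≤ θ) (hy0 : ∀ t ∈ Ico a b, 0 ≤ y t)
    (hy : ∀ t ∈ Ico a b, y t ≤ E (z + (t - a))) (hlim : Tendsto y (𝓝[<] b) (𝓝 yb)) :
    α yb ≤ E (z - δ) := by
  have hmem : ∀ᶠ t in 𝓝[<] b, t ∈ Ico a b := Ico_mem_nhdsLT hab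
  have hyb0 : 0 ≤ yb := ge_of_tendsto hlim (hmem.mono hy0)
  have hyb : yb ≤ E (z + θ) := le_of_tendsto hlim <| hmem.mono fun t ht =>
    (hy t ht).trans (h.strictMono.monotone (by linarith [ht.2]))
  rcases eq_or_lt_of_le hyb0 with rfl | hpos
  · rw [hα.2.1]
    exact (h.pos _).le
  · have hFyb := (h.le_inverse_iff hpos).1 hyb
    have hαpos := hα.2.2 _ hpos
    have hdrop := hFDT _ hpos
    rw [h.integral_eq _ hαpos _ hpos] at hdrop
    rw [h.le_inverse_iff hαpos]
    linarith

end timeFlow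

/-- Decay estimate for a Lyapunov trajectory, at levels `r` and `c` that dominate the initial value
and the input term. -/
lemma LyapTraj.le_max {ψ F E : ℝ → ℝ} (h : TimeCoordinate ψ F E) (hψpos : ∀ s > 0, 0 < ψ s)
    {α χ : ℝ → ℝ} (hα : PosDef α) {θ δ : ℝ} (hθ : 0 < θ) (hδ : 0 < δ)
    (hFDT : ∀ a > (0:ℝ), θ + δ ≤ ∫ s in (α a)..a, 1 / ψ s) {t0 u : ℝ} {T : ℕ → ℝ}
    (hT : ImpulseSeq t0 T) (hT0 : T 0 - t0 ≤ θ) (hTi : ∀ i, T (i + 1) - T i ≤ θ)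
    {y : ℝ → ℝ} {ym : ℕ → ℝ} (hy : LyapTraj t0 T u ψ α χ y ym) {r c : ℝ} (hr : 0 < r) (hc : 0 < c)
    (hyr : y t0 ≤ r) (hχc : χ u ≤ c) {t : ℝ} (ht : t0 ≤ t) :
    y t ≤ max (E (F r + (θ + δ - δ / θ * (t - t0)))) (E (F c + θ)) := by
  obtain ⟨hTm, hTt0, hTlim⟩ := hT
  obtain ⟨hy0, hyc0, hyc, hylim, hyd, hyψ, hyj⟩ := hy
  have hmono := h.strictMono.monotone
  have hE : ∀ z w, max (E z) (E w) = E (max z w) := fun z w => (hmono.map_max).symm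
  have ht0T : ∀ i, t0 < T i := fun i => hTt0.trans_le (hTm.monotone i.zero_le)
  have hflow : ∀ a b z, t0 ≤ a → ContinuousOn y (Ico a b) → (∀ t ∈ Ioo a b, ∀ i, t ≠ T i) →
      F c ≤ z → y a ≤ E z → ∀ t ∈ Ico a b, y t ≤ E (z + (t - a)) := by
    intro a b z ha hcont hne hz hya
    have hcz : c ≤ E z := (h.le_inverse_iff hc).2 hz
    have := le_inverse_of_deriv_le h hψpos (h.pos z) hcont
      (fun t ht => hyd t (ha.trans ht.1.le) (hne t ht))
      (fun t ht hle => hyψ t (ha.trans ht.1.le) (hne t ht) (hχc.trans (hcz.trans hle))) hya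
    simpa only [h.apply_inverse] using this
  have hflow0 : ∀ t ∈ Ico t0 (T 0), y t ≤ E (max (F r) (F c) + (t - t0)) := by
    refine hflow _ _ _ le_rfl hyc0 (fun t ht i => ?_) (le_max_right _ _) ?_
    · exact (ht.2.trans_le (hTm.monotone i.zero_le)).ne
    · refine hyr.trans ((h.inverse_apply r hr).symm.le.trans (hmono (le_max_left _ _)))
  have hflowi : ∀ i z, F c ≤ z → y (T i) ≤ E z →
      ∀ t ∈ Ico (T i) (T (i + 1)), y t ≤ E (z + (t - T i)) := by
    intro i z hz hyz
    refine hflow _ _ _ (ht0T i).le (hyc i) (fun t ht j => ?_) hz hyz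
    rcases le_or_gt j i with hji | hij
    · exact (lt_of_le_of_lt (hTm.monotone hji) ht.1).ne'
    · exact (lt_of_lt_of_le ht.2 (hTm.monotone hij)).ne
  have hjump : ∀ i z, α (ym i) ≤ E (max z (F c) - δ) → y (T i) ≤ E (max (z - δ) (F c)) := by
    intro i z hz
    refine (hyj i).trans (max_le (hz.trans (hmono ?_)) (hχc.trans ?_))
    · rw [sub_le_iff_le_add]
      refine max_le ?_ ?_
      · linarith [le_max_left (z - δ) (F c)]
      · linarith [le_max_right (z - δ) (F c)]
    · exact (h.le_inverse_iff hc).2 (le_max_right _ _)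
  have hjumps : ∀ i : ℕ, y (T i) ≤ E (max (F r - (i + 1) * δ) (F c)) := by
    intro i
    induction i with
    | zero =>
      simpa using hjump 0 (F r) (jump_le h hα hFDT hTt0 hT0 (fun t ht => hy0 t ht.1) hflow0 (hylim 0))
    | succ i ih =>
      have := hjump (i + 1) _ (jump_le h hα hFDT (hTm i.lt_succ_self) (hTi i)
        (fun t ht => hy0 t ((ht0T i).le.trans ht.1)) (hflowi i _ (le_max_right _ _) ih)
        (hylim (i + 1)))
      convert this using 3
      push_cast
      ring
  have htime : ∀ i : ℕ, T i - t0 ≤ (i + 1) * θ := by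
    intro i
    induction i with
    | zero => simpa using hT0
    | succ i ih =>
      push_cast
      linarith [hTi i]
  have hδθ : ∀ s k : ℝ, s ≤ k * θ → δ / θ * s ≤ k * δ := by
    intro s k hs
    rw [div_mul_eq_mul_div, div_le_iff₀ hθ]
    nlinarith
  rw [hE]
  rcases lt_or_ge t (T 0) with htT | htT
  · refine (hflow0 t ⟨ht, htT⟩).trans (hmono ?_)
    have := hδθ (t - t0) 1 (by linarith)
    rw [← max_add_add_right]
    exact max_le_max (by linarith) (by linarith)
  · obtain ⟨i, hi, hi'⟩ : ∃ i, T i ≤ t ∧ t < T (i + 1) := by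
      have hex : ∃ n, t < T n := (hTlim.eventually_gt_atTop t).exists
      classical
      obtain ⟨i, hi⟩ : ∃ i, Nat.find hex = i + 1 := Nat.exists_eq_succ_of_ne_zero fun h0 => by
        have := Nat.find_spec hex
        rw [h0] at this
        exact this.not_ge htT
      refine ⟨i, not_lt.1 (Nat.find_min hex (by omega)), ?_⟩
      have := Nat.find_spec hex
      rwa [hi] at this
    refine (hflowi i _ (le_max_right _ _) (hjumps i) t ⟨hi, hi'⟩).trans (hmono ?_)
    have := hδθ (t - t0) (i + 2) (by linarith [htime i, hTi i])
    rw [← max_add_add_right]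
    exact max_le_max (by linarith [hTi i]) (by linarith [hTi i])

/-- ISS over the class `S̃_θ` (impulses at least every `θ` units of
time) under the reversed fixed dwell-time condition
`∫_{α(a)}^a ds/ψ(s) ≥ θ + δ`, for destabilizing continuous dynamics
(`ω(s) = ψ(s)`) and stabilizing jumps; the gain `γ` is independent of
`T ∈ S̃_θ`. -/
theorem stmt_7 {X : Type*} [NormedAddCommGroup X]
    (t0 : ℝ) (ψ₁ ψ₂ : ℝ → ℝ) (hψ₁ : ClassKinf ψ₁) (hψ₂ : ClassKinf ψ₂)
    (V : X → ℝ) (hVc : Continuous V) (hVnn : ∀ x, 0 ≤ V x)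
    (hVlow : ∀ x : X, ψ₁ ‖x‖ ≤ V x) (hVup : ∀ x : X, V x ≤ ψ₂ ‖x‖)
    (ψ α : ℝ → ℝ) (hψ : PosDef ψ)
    (hψdiv : Filter.Tendsto (fun b => ∫ s in (1:ℝ)..b, 1 / ψ s)
      Filter.atTop Filter.atTop)
    (hα : PosDef α)
    (χ : ℝ → ℝ) (hχ : ClassKinf χ)
    (θ δ : ℝ) (hθ : 0 < θ) (hδ : 0 < δ)
    (hFDT : ∀ a > (0:ℝ), θ + δ ≤ ∫ s in (α a)..a, 1 / ψ s) :
    ∃ γ : ℝ → ℝ, ClassK γ ∧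
      ∀ T : ℕ → ℝ, ImpulseSeq t0 T →
        T 0 - t0 ≤ θ → (∀ i, T (i+1) - T i ≤ θ) →
        ∃ β : ℝ → ℝ → ℝ, ClassKL β ∧
          ∀ u ≥ (0:ℝ), ∀ x : ℝ → X, ∀ ym : ℕ → ℝ,
            LyapTraj t0 T u (fun s => ψ s) α χ (fun t => V (x t)) ym →
            ∀ t ≥ t0, ‖x t‖ ≤ β ‖x t0‖ (t - t0) + γ u := by
  obtain ⟨F, E, h⟩ := exists_timeCoordinate hψ hψdiv hα (add_pos hθ hδ) hFDT
  obtain ⟨g, hgc, hgm, hg0, hg⟩ := hψ₁.exists_inverse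
  obtain ⟨⟨hψ₂c, hψ₂m, hψ₂0⟩, -⟩ := hψ₂
  obtain ⟨⟨hχc, hχm, hχ0⟩, -⟩ := hχ
  have hψ₂nn : ∀ r, 0 ≤ r → 0 ≤ ψ₂ r := fun r hr =>
    hψ₂0 ▸ hψ₂m.monotoneOn self_mem_Ici hr hr
  have hχnn : ∀ r, 0 ≤ r → 0 ≤ χ r := fun r hr =>
    hχ0 ▸ hχm.monotoneOn self_mem_Ici hr hr
  have hΦ := continuous_timeFlow h
  have hgnn : ∀ r s, 0 ≤ g (timeFlow F E r s) := fun r s =>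
    hg0 ▸ hgm.monotone (timeFlow_nonneg h r s)
  refine ⟨fun u => g (timeFlow F E (χ u) θ), ⟨?_, ?_, ?_⟩, ?_⟩
  · exact hgc.comp_continuousOn (hΦ.comp_continuousOn (hχc.prodMk continuousOn_const))
  · exact fun a ha b hb hab =>
      hgm (timeFlow_strictMonoOn h θ (hχnn a ha) (hχnn b hb) (hχm ha hb hab))
  · simp only [hχ0, timeFlow_of_nonpos le_rfl, hg0]
  intro T hT hT0 hTi
  have hδθ : 0 < δ / θ := div_pos hδ hθ
  refine ⟨fun r t => g (timeFlow F E (ψ₂ r) (θ + δ - δ / θ * t)), ⟨?_, fun t _ => ⟨?_, ?_, ?_⟩,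
    fun r hr => ⟨?_, ?_, ?_⟩⟩, ?_⟩
  · refine hgc.comp_continuousOn (hΦ.comp_continuousOn (ContinuousOn.prodMk ?_ (by fun_prop)))
    exact hψ₂c.comp continuousOn_fst fun p hp => hp.1
  · exact hgc.comp_continuousOn (hΦ.comp_continuousOn (hψ₂c.prodMk continuousOn_const))
  · exact fun a ha b hb hab =>
      hgm (timeFlow_strictMonoOn h _ (hψ₂nn a ha) (hψ₂nn b hb) (hψ₂m ha hb hab))
  · simp only [hψ₂0, timeFlow_of_nonpos le_rfl, hg0]
  · exact hgc.comp_continuousOn (hΦ.comp_continuousOn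
      (continuousOn_const.prodMk (g := fun t => θ + δ - δ / θ * t) (by fun_prop)))
  · have hψ₂r : 0 < ψ₂ r := hψ₂0 ▸ hψ₂m self_mem_Ici hr.le hr
    intro a _ b _ hab
    simp only [timeFlow_of_pos hψ₂r]
    refine hgm (h.strictMono ?_)
    linarith [mul_lt_mul_of_pos_left hab hδθ]
  · have hψ₂r : 0 < ψ₂ r := hψ₂0 ▸ hψ₂m self_mem_Ici hr.le hr
    simp only [timeFlow_of_pos hψ₂r]
    rw [← hg0]
    refine (hgc.tendsto 0).comp (h.tendsto_atBot.comp ?_)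
    refine tendsto_atBot_add_const_left _ _ ?_
    simp only [sub_eq_add_neg]
    exact tendsto_atBot_add_const_left _ _
      (tendsto_neg_atTop_atBot.comp (tendsto_id.const_mul_atTop hδθ))
  intro u hu x ym hy t ht
  have hV : V (x t) ≤ max (timeFlow F E (ψ₂ ‖x t0‖) (θ + δ - δ / θ * (t - t0)))
      (timeFlow F E (χ u) θ) := by
    have hlim : ∀ q s : ℝ, Tendsto (fun ε => timeFlow F E (q + ε) s) (𝓝[>] 0)
        (𝓝 (timeFlow F E q s)) := fun q s => by
      have : Continuous fun ε => timeFlow F E (q + ε) s :=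
        hΦ.comp ((continuous_const.add continuous_id).prodMk continuous_const)
      simpa using (this.tendsto 0).mono_left nhdsWithin_le_nhds
    refine ge_of_tendsto ((hlim _ _).max (hlim _ _)) ?_
    filter_upwards [self_mem_nhdsWithin] with ε hε
    have hr : 0 < ψ₂ ‖x t0‖ + ε := add_pos_of_nonneg_of_pos (hψ₂nn _ (norm_nonneg _)) hε
    have hc : 0 < χ u + ε := add_pos_of_nonneg_of_pos (hχnn u hu) hε
    rw [timeFlow_of_pos hr, timeFlow_of_pos hc]
    exact LyapTraj.le_max h hψ.2.2 hα hθ hδ hFDT hT hT0 hTi hy hr hc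
      ((hVup _).trans (le_add_of_nonneg_right (le_of_lt hε)))
      (le_add_of_nonneg_right (le_of_lt hε)) ht
  calc ‖x t‖ = g (ψ₁ ‖x t‖) := (hg _ (norm_nonneg _)).symm
    _ ≤ g (max (timeFlow F E (ψ₂ ‖x t0‖) (θ + δ - δ / θ * (t - t0))) (timeFlow F E (χ u) θ)) :=
      hgm.monotone ((hVlow _).trans hV)
    _ ≤ _ := by
      rw [hgm.monotone.map_max]
      exact max_le_add_of_nonneg (hgnn _ _) (hgnn _ _)
end

section
/- Let c, d ∈ ℝ and s ≤ t be reals. Let t_1 < t_2 < … < t_m be finitely many points in (s, t], and let y : [s,t] → [0,∞) satisfy: y is continuous on [s,t_1) and on each interval [t_k, t_{k+1}) and on [t_m, t]; y has a finite left limit y⁻(t_k) at each t_k; y is differentiable at every τ ∈ [s,t] not equal to any t_k, with y′(τ) ≤ −c·y(τ); and y(t_k) ≤ e^{−d}·y⁻(t_k) for each k = 1,…,m. Then y(t) ≤ e^{−d·m − c·(t−s)}·y(s). -/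
open Set Filter Topology

/-- Differential Grönwall inequality on a closed interval: `y' ≤ -c * y` forces exponential decay
at rate `c`. -/
theorem le_exp_mul_of_deriv_le {c a b : ℝ} {y : ℝ → ℝ} (hab : a ≤ b)
    (hc : ContinuousOn y (Icc a b)) (hd : ∀ τ ∈ Ioo a b, DifferentiableAt ℝ y τ)
    (hle : ∀ τ ∈ Ioo a b, deriv y τ ≤ -c * y τ) :
    y b ≤ Real.exp (-c * (b - a)) * y a := by
  have hder : ∀ τ ∈ Ioo a b, HasDerivAt (fun x => Real.exp (c * x) * y x)
      (Real.exp (c * τ) * (c * y τ + deriv y τ)) τ := fun τ hτ => by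
    have h := (((hasDerivAt_id τ).const_mul c).exp).mul (hd τ hτ).hasDerivAt
    refine h.congr_deriv ?_
    simp only [id]
    ring
  have hanti : AntitoneOn (fun x => Real.exp (c * x) * y x) (Icc a b) := by
    refine antitoneOn_of_deriv_nonpos (convex_Icc a b) ?_ ?_ ?_
    · exact ContinuousOn.mul (by fun_prop) hc
    · rw [interior_Icc]
      exact fun τ hτ => (hder τ hτ).differentiableAt.differentiableWithinAt
    · rw [interior_Icc]
      intro τ hτ
      rw [(hder τ hτ).deriv]
      exact mul_nonpos_of_nonneg_of_nonpos (Real.exp_pos _).le (by linarith [hle τ hτ])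
  have h : Real.exp (c * b) * y b ≤ Real.exp (c * a) * y a :=
    hanti (left_mem_Icc.2 hab) (right_mem_Icc.2 hab) hab
  calc y b = Real.exp (-(c * b)) * (Real.exp (c * b) * y b) := by
        rw [← mul_assoc, ← Real.exp_add]; simp
    _ ≤ Real.exp (-(c * b)) * (Real.exp (c * a) * y a) := by gcongr
    _ = Real.exp (-c * (b - a)) * y a := by
        rw [← mul_assoc, ← Real.exp_add]; ring_nf

/-- Differential Grönwall inequality for the left limit at the right endpoint. -/
theorem leftLim_le_exp_mul_of_deriv_le {c a b l : ℝ} {y : ℝ → ℝ} (hab : a < b)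
    (hc : ContinuousOn y (Ico a b)) (hd : ∀ τ ∈ Ioo a b, DifferentiableAt ℝ y τ)
    (hle : ∀ τ ∈ Ioo a b, deriv y τ ≤ -c * y τ) (hl : Tendsto y (𝓝[<] b) (𝓝 l)) :
    l ≤ Real.exp (-c * (b - a)) * y a := by
  have hcont : Continuous fun x => Real.exp (-c * (x - a)) * y a := by fun_prop
  refine le_of_tendsto_of_tendsto hl ((hcont.tendsto b).mono_left nhdsWithin_le_nhds) ?_
  filter_upwards [Ioo_mem_nhdsLT hab] with x hx
  have hsub : Ioo a x ⊆ Ioo a b := Ioo_subset_Ioo_right hx.2.le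
  exact le_exp_mul_of_deriv_le hx.1.le (hc.mono (Icc_subset_Ico_right hx.2))
    (fun τ hτ => hd τ (hsub hτ)) (fun τ hτ => hle τ (hsub hτ))

/-- impulsive Grönwall-type estimate: along `[s,t]` containing the
impulse times `t_1 < … < t_m`, a nonnegative function decaying at exponential
rate `c` along the flow and contracting by `e^{-d}` at each jump satisfies
`y(t) ≤ e^{-d·m - c·(t-s)}·y(s)`. -/
theorem stmt_9 (c d s t : ℝ) (hst : s ≤ t) (m : ℕ) (hm : 1 ≤ m)
    (tk : Fin m → ℝ) (htkmono : StrictMono tk)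
    (htkmem : ∀ k, tk k ∈ Set.Ioc s t)
    (y : ℝ → ℝ) (ym : Fin m → ℝ)
    (hnn : ∀ τ ∈ Set.Icc s t, 0 ≤ y τ)
    (hc0 : ContinuousOn y (Set.Ico s (tk ⟨0, by omega⟩)))
    (hck : ∀ k : Fin m, ContinuousOn y
      (if h : (k : ℕ) + 1 < m then Set.Ico (tk k) (tk ⟨(k : ℕ) + 1, h⟩)
       else Set.Icc (tk k) t))
    (hlim : ∀ k, Filter.Tendsto y (nhdsWithin (tk k) (Set.Iio (tk k)))
      (nhds (ym k)))
    (hderiv : ∀ τ ∈ Set.Icc s t, (∀ k, τ ≠ tk k) → DifferentiableAt ℝ y τ)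
    (hdle : ∀ τ ∈ Set.Icc s t, (∀ k, τ ≠ tk k) → deriv y τ ≤ -c * y τ)
    (hjump : ∀ k, y (tk k) ≤ Real.exp (-d) * ym k) :
    y t ≤ Real.exp (-d * m - c * (t - s)) * y s := by
  have flow_jump : ∀ (a : ℝ) (k : Fin m), s ≤ a → a < tk k → ContinuousOn y (Ico a (tk k)) →
      (∀ j, tk j ≤ a ∨ tk k ≤ tk j) →
      y (tk k) ≤ Real.exp (-d) * (Real.exp (-c * (tk k - a)) * y a) := by
    intro a k hsa hak hcont hout
    have hmem : ∀ τ ∈ Ioo a (tk k), τ ∈ Icc s t ∧ ∀ j, τ ≠ tk j := fun τ hτ =>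
      ⟨⟨hsa.trans hτ.1.le, hτ.2.le.trans (htkmem k).2⟩, fun j hj =>
        (hout j).elim (fun h => (hj ▸ hτ.1).not_ge h) (fun h => (hj ▸ hτ.2).not_ge h)⟩
    refine (hjump k).trans (mul_le_mul_of_nonneg_left ?_ (Real.exp_pos _).le)
    exact leftLim_le_exp_mul_of_deriv_le hak hcont
      (fun τ hτ => hderiv τ (hmem τ hτ).1 (hmem τ hτ).2)
      (fun τ hτ => hdle τ (hmem τ hτ).1 (hmem τ hτ).2) (hlim k)
  have at_jump : ∀ (n : ℕ) (hn : n < m),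
      y (tk ⟨n, hn⟩) ≤ Real.exp (-d * (n + 1 : ℕ) - c * (tk ⟨n, hn⟩ - s)) * y s := by
    intro n
    induction n with
    | zero =>
      intro hn
      refine (flow_jump s ⟨0, hn⟩ le_rfl (htkmem _).1 hc0
        fun j => Or.inr (htkmono.monotone (Nat.zero_le _))).trans_eq ?_
      rw [← mul_assoc, ← Real.exp_add]
      push_cast
      ring_nf
    | succ n ih =>
      intro hn
      have hn' : n < m := by omega
      have hcont := hck ⟨n, hn'⟩
      rw [dif_pos hn] at hcont
      have hlt : tk ⟨n, hn'⟩ < tk ⟨n + 1, hn⟩ := htkmono (Fin.mk_lt_mk.2 n.lt_succ_self)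
      have hout : ∀ j, tk j ≤ tk ⟨n, hn'⟩ ∨ tk ⟨n + 1, hn⟩ ≤ tk j := fun j => by
        rw [htkmono.le_iff_le, htkmono.le_iff_le, Fin.le_def, Fin.le_def]
        exact le_or_gt _ _
      calc y (tk ⟨n + 1, hn⟩)
          ≤ Real.exp (-d) * (Real.exp (-c * (tk ⟨n + 1, hn⟩ - tk ⟨n, hn'⟩)) *
              y (tk ⟨n, hn'⟩)) := flow_jump _ _ (htkmem _).1.le hlt hcont hout
        _ ≤ Real.exp (-d) * (Real.exp (-c * (tk ⟨n + 1, hn⟩ - tk ⟨n, hn'⟩)) *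
              (Real.exp (-d * (n + 1 : ℕ) - c * (tk ⟨n, hn'⟩ - s)) * y s)) := by
            gcongr
            exact ih hn'
        _ = Real.exp (-d * (n + 1 + 1 : ℕ) - c * (tk ⟨n + 1, hn⟩ - s)) * y s := by
            rw [← mul_assoc, ← mul_assoc, ← Real.exp_add, ← Real.exp_add]
            push_cast
            ring_nf
  obtain ⟨n, rfl⟩ : ∃ n, m = n + 1 := ⟨m - 1, by omega⟩
  have hcont := hck (Fin.last n)
  rw [dif_neg (by simp)] at hcont
  have hmem : ∀ τ ∈ Ioo (tk (Fin.last n)) t, τ ∈ Icc s t ∧ ∀ j, τ ≠ tk j := fun τ hτ =>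
    ⟨⟨(htkmem _).1.le.trans hτ.1.le, hτ.2.le⟩, fun j hj =>
      (hj ▸ hτ.1).not_ge (htkmono.monotone (Fin.le_last j))⟩
  calc y t ≤ Real.exp (-c * (t - tk (Fin.last n))) * y (tk (Fin.last n)) :=
        le_exp_mul_of_deriv_le (htkmem _).2 hcont
          (fun τ hτ => hderiv τ (hmem τ hτ).1 (hmem τ hτ).2)
          (fun τ hτ => hdle τ (hmem τ hτ).1 (hmem τ hτ).2)
    _ ≤ Real.exp (-c * (t - tk (Fin.last n))) *
          (Real.exp (-d * (n + 1 : ℕ) - c * (tk (Fin.last n) - s)) * y s) := by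
        gcongr
        exact at_jump n n.lt_succ_self
    _ = Real.exp (-d * (n + 1 : ℕ) - c * (t - s)) * y s := by
        rw [← mul_assoc, ← Real.exp_add]
        ring_nf
end

section
/- Let X and U be normed spaces, ψ₁, ψ₂ ∈ K∞, and V : X → [0,∞) be continuous with ψ₁(‖x‖) ≤ V(x) ≤ ψ₂(‖x‖) for all x ∈ X. Let α be positive definite, χ ∈ K∞, and let g : X × U → X be locally bounded (bounded on bounded subsets of X × U), continuous at (0,0), with g(0,0) = 0. Suppose that for all x ∈ X and ξ ∈ U, V(x) ≥ χ(‖ξ‖) implies V(g(x,ξ)) ≤ α(V(x)). Then there exists γ of class K with γ(r) ≥ χ(r) for all r ≥ 0 such that V(g(x,ξ)) ≤ max{α(V(x)), γ(‖ξ‖)} for all x ∈ X and ξ ∈ U. -/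
open Set Filter Topology

/-- A monotone function that is continuous at `0` has, on `[0, ∞)`, a continuous monotone
majorant with the same value at `0`, namely its average `r ↦ ∫ s in 1..2, w (r * s)`. -/
lemma exists_continuousOn_monotoneOn_majorant {w : ℝ → ℝ} (hw : Monotone w)
    (hw0 : ContinuousAt w 0) :
    ∃ W : ℝ → ℝ, ContinuousOn W (Ici 0) ∧ MonotoneOn W (Ici 0) ∧ W 0 = w 0 ∧
      ∀ r, 0 ≤ r → w r ≤ W r := by
  have hint : ∀ r, 0 ≤ r → IntervalIntegrable (fun s => w (r * s)) MeasureTheory.volume 1 2 :=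
    fun r hr => Monotone.intervalIntegrable
      fun a b hab => hw (mul_le_mul_of_nonneg_left hab hr)
  have hlow : ∀ r, 0 ≤ r → w r ≤ ∫ s in (1:ℝ)..2, w (r * s) := by
    intro r hr
    have h := intervalIntegral.integral_mono_on (a := (1:ℝ)) (b := 2) (by norm_num)
      intervalIntegrable_const (hint r hr)
      fun s hs => hw (le_mul_of_one_le_right hr hs.1)
    norm_num at h
    exact h
  have hupp : ∀ r, 0 ≤ r → ∫ s in (1:ℝ)..2, w (r * s) ≤ w (r * 2) := by
    intro r hr
    have h := intervalIntegral.integral_mono_on (a := (1:ℝ)) (b := 2) (by norm_num)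
      (hint r hr) intervalIntegrable_const
      fun s hs => hw (mul_le_mul_of_nonneg_left hs.2 hr)
    norm_num at h
    exact h
  refine ⟨fun r => ∫ s in (1:ℝ)..2, w (r * s), ?_, ?_, by norm_num, hlow⟩
  · intro r hr
    rcases (mem_Ici.1 hr).eq_or_lt with rfl | hr
    · have hlim : Tendsto (fun r : ℝ => w (r * 2)) (𝓝[Ici 0] 0) (𝓝 (w 0)) := by
        have h2 : Tendsto (fun r : ℝ => r * 2) (𝓝[Ici 0] 0) (𝓝 0) := by
          have h : Continuous fun r : ℝ => r * 2 := by fun_prop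
          simpa using (h.tendsto 0).mono_left nhdsWithin_le_nhds
        exact hw0.tendsto.comp h2
      have h : Tendsto (fun r => ∫ s in (1:ℝ)..2, w (r * s)) (𝓝[Ici 0] 0) (𝓝 (w 0)) :=
        tendsto_of_tendsto_of_tendsto_of_le_of_le'
          (hw0.tendsto.mono_left nhdsWithin_le_nhds) hlim
          (eventually_mem_nhdsWithin.mono hlow) (eventually_mem_nhdsWithin.mono hupp)
      have h1 : ∫ s in (1:ℝ)..2, w (0 * s) = w 0 := by norm_num
      rwa [← h1] at h
    · have hww : ∀ a b, IntervalIntegrable w MeasureTheory.volume a b :=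
        fun a b => hw.intervalIntegrable
      have hprim := intervalIntegral.continuous_primitive hww 0
      have hcont : ContinuousAt
          (fun r => r⁻¹ * ((∫ s in (0:ℝ)..(r * 2), w s) - ∫ s in (0:ℝ)..r, w s)) r := by
        refine (continuousAt_inv₀ hr.ne').mul (Continuous.continuousAt ?_)
        exact (hprim.comp (by fun_prop : Continuous fun r : ℝ => r * 2)).sub hprim
      refine (hcont.congr ?_).continuousWithinAt
      filter_upwards [lt_mem_nhds hr] with t ht
      rw [intervalIntegral.integral_interval_sub_left (hww _ _) (hww _ _),
        intervalIntegral.integral_comp_mul_left w ht.ne', mul_one, smul_eq_mul]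
  · intro a ha b hb hab
    exact intervalIntegral.integral_mono_on (by norm_num) (hint a ha) (hint b hb)
      fun s hs => hw (mul_le_mul_of_nonneg_right hab (by linarith [hs.1]))

/-- the implication-form jump estimate implies the
dissipative (maximum) form jump estimate with a class `K` gain `γ ≥ χ`, for a
locally bounded jump map `g` which is continuous at `(0,0)` with `g(0,0) = 0`. -/
theorem stmt_12 {X U : Type*} [NormedAddCommGroup X] [NormedAddCommGroup U]
    (ψ₁ ψ₂ : ℝ → ℝ) (hψ₁ : ClassKinf ψ₁) (hψ₂ : ClassKinf ψ₂)
    (V : X → ℝ) (hVc : Continuous V) (hVnn : ∀ x, 0 ≤ V x)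
    (hVlow : ∀ x : X, ψ₁ ‖x‖ ≤ V x) (hVup : ∀ x : X, V x ≤ ψ₂ ‖x‖)
    (α χ : ℝ → ℝ) (hα : PosDef α) (hχ : ClassKinf χ)
    (g : X × U → X)
    (hgb : ∀ ρ > (0:ℝ), ∃ K : ℝ, ∀ (x : X) (ξ : U),
      ‖x‖ ≤ ρ → ‖ξ‖ ≤ ρ → ‖g (x, ξ)‖ ≤ K)
    (hgc : ContinuousAt g (0, 0)) (hg0 : g (0, 0) = 0)
    (himp : ∀ (x : X) (ξ : U), χ ‖ξ‖ ≤ V x → V (g (x, ξ)) ≤ α (V x)) :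
    ∃ γ : ℝ → ℝ, ClassK γ ∧ (∀ r ≥ (0:ℝ), χ r ≤ γ r) ∧
      ∀ (x : X) (ξ : U), V (g (x, ξ)) ≤ max (α (V x)) (γ ‖ξ‖) := by
  obtain ⟨⟨-, hψ₁m, hψ₁0⟩, hψ₁t⟩ := hψ₁
  obtain ⟨⟨hχc, hχm, hχ0⟩, -⟩ := hχ
  have hV0 : V 0 = 0 := by
    refine le_antisymm ?_ (hVnn 0)
    simpa [hψ₂.1.2.2] using hVup 0
  let A : ℝ → Set ℝ := fun r =>
    {v | ∃ (x : X) (ξ : U), ‖ξ‖ ≤ max r 0 ∧ V x ≤ χ (max r 0) ∧ V (g (x, ξ)) = v}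
  have hχnn : ∀ r, 0 ≤ r → 0 ≤ χ r := fun r hr => by
    simpa [hχ0] using hχm.monotoneOn self_mem_Ici hr hr
  have hA0 : ∀ r, (0 : ℝ) ∈ A r := fun r =>
    ⟨0, 0, by simp, by simpa [hV0] using hχnn _ (le_max_right r 0), by rw [hg0, hV0]⟩
  have hAb : ∀ r, BddAbove (A r) := by
    intro r
    obtain ⟨R, hR⟩ := eventually_atTop.1
      ((hψ₁t.eventually_gt_atTop (χ (max r 0))).and (eventually_ge_atTop (max r 1)))
    have hR1 : max r 1 ≤ R := (hR R le_rfl).2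
    have hRpos : 0 < R := zero_lt_one.trans_le ((le_max_right _ _).trans hR1)
    obtain ⟨K, hK⟩ := hgb R hRpos
    refine ⟨ψ₂ K, ?_⟩
    rintro _ ⟨x, ξ, hξ, hx, rfl⟩
    have hxR : ‖x‖ ≤ R := by
      by_contra! h
      linarith [(hR _ h.le).1, hVlow x]
    have hg := hK x ξ hxR (hξ.trans (max_le ((le_max_left _ _).trans hR1) hRpos.le))
    exact (hVup _).trans
      (hψ₂.1.2.1.monotoneOn (norm_nonneg _) ((norm_nonneg _).trans hg) hg)
  have hAm : Monotone A := by
    rintro a b hab _ ⟨x, ξ, hξ, hx, rfl⟩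
    have h : max a 0 ≤ max b 0 := max_le_max_right 0 hab
    exact ⟨x, ξ, hξ.trans h,
      hx.trans (hχm.monotoneOn (le_max_right a 0) (le_max_right b 0) h), rfl⟩
  let w : ℝ → ℝ := fun r => sSup (A r)
  have hwm : Monotone w := fun a b hab => csSup_le_csSup (hAb b) ⟨0, hA0 a⟩ (hAm hab)
  have hwnn : ∀ r, 0 ≤ w r := fun r => le_csSup (hAb r) (hA0 r)
  have hsmall : ∀ ε > 0, ∀ᶠ r in 𝓝 (0:ℝ), w r ≤ ε := by
    intro ε hε
    have hVg : Tendsto (fun p => V (g p)) (𝓝 (0, 0)) (𝓝 0) := by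
      have h : ContinuousAt (fun p => V (g p)) (0, 0) := hVc.continuousAt.comp hgc
      simpa [ContinuousAt, hg0, hV0] using h
    obtain ⟨δ, hδ, hball⟩ := Metric.eventually_nhds_iff.1 (hVg.eventually_lt_const hε)
    have hχlim : Tendsto (fun r : ℝ => χ (max r 0)) (𝓝 0) (𝓝 0) := by
      have hc : Continuous fun r : ℝ => χ (max r 0) :=
        hχc.comp_continuous (by fun_prop) fun r => le_max_right r 0
      simpa [hχ0] using hc.tendsto 0
    have hψδ : 0 < ψ₁ δ := by
      have h := hψ₁m self_mem_Ici hδ.le hδ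
      rwa [hψ₁0] at h
    filter_upwards [hχlim.eventually_lt_const hψδ, gt_mem_nhds hδ] with r hr hrδ
    refine csSup_le ⟨0, hA0 r⟩ ?_
    rintro _ ⟨x, ξ, hξ, hx, rfl⟩
    have hxδ : ‖x‖ < δ := by
      refine (hψ₁m.lt_iff_lt (norm_nonneg x) hδ.le).1 ?_
      linarith [hVlow x]
    refine (hball ?_).le
    simpa [Prod.dist_eq] using ⟨hxδ, hξ.trans_lt (max_lt hrδ hδ)⟩
  have hw0 : w 0 = 0 :=
    le_antisymm (le_of_forall_pos_le_add fun ε hε => by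
      simpa using (hsmall ε hε).self_of_nhds) (hwnn 0)
  have hwc : ContinuousAt w 0 := by
    rw [ContinuousAt, hw0]
    refine tendsto_order.2 ⟨fun a ha => Eventually.of_forall fun r => ha.trans_le (hwnn r),
      fun a ha => ?_⟩
    exact (hsmall (a / 2) (half_pos ha)).mono fun r hr => hr.trans_lt (half_lt_self ha)
  obtain ⟨W, hWc, hWm, hW0, hwW⟩ := exists_continuousOn_monotoneOn_majorant hwm hwc
  refine ⟨fun r => χ r + W r,
    ⟨hχc.add hWc, hχm.add_monotone hWm, by simp [hχ0, hW0, hw0]⟩, fun r hr => ?_, fun x ξ => ?_⟩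
  · linarith [hwnn r, hwW r hr]
  · rcases le_total (χ ‖ξ‖) (V x) with h | h
    · exact (himp x ξ h).trans (le_max_left _ _)
    · refine le_max_of_le_right ?_
      have hmem : V (g (x, ξ)) ∈ A ‖ξ‖ := ⟨x, ξ, by simp, by simpa using h, rfl⟩
      have hle : V (g (x, ξ)) ≤ w ‖ξ‖ := le_csSup (hAb _) hmem
      linarith [hwW _ (norm_nonneg ξ), hχnn _ (norm_nonneg ξ)]
end

section
/- Let X and U be normed spaces, V : X → [0,∞), g : X × U → X, d ∈ ℝ, γ ∈ K∞, and suppose V(g(x,ξ)) ≤ max{e^{−d}·V(x), γ(‖ξ‖)} for all x ∈ X and ξ ∈ U. Then for every d′ < d, defining χ(r) := max{γ(r), e^{d′}·γ(r)} for r ≥ 0, one has χ ∈ K∞ and, for all x ∈ X and ξ ∈ U with V(x) ≥ χ(‖ξ‖), V(g(x,ξ)) ≤ e^{−d′}·V(x). -/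
open Set Filter Topology

/-- a dissipative-form exponential jump estimate with rate
coefficient `d` yields an implication-form exponential jump estimate with any
`d' < d`, with gain `χ(r) = max{γ(r), e^{d'}·γ(r)}`. -/
theorem stmt_13 {X U : Type*} [NormedAddCommGroup X] [NormedAddCommGroup U]
    (V : X → ℝ) (hVnn : ∀ x, 0 ≤ V x)
    (g : X × U → X) (d : ℝ) (γ : ℝ → ℝ) (hγ : ClassKinf γ)
    (hjump : ∀ (x : X) (ξ : U),
      V (g (x, ξ)) ≤ max (Real.exp (-d) * V x) (γ ‖ξ‖))
    (d' : ℝ) (hd' : d' < d) :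
    ClassKinf (fun r => max (γ r) (Real.exp d' * γ r)) ∧
    ∀ (x : X) (ξ : U), max (γ ‖ξ‖) (Real.exp d' * γ ‖ξ‖) ≤ V x →
      V (g (x, ξ)) ≤ Real.exp (-d') * V x := by
  obtain ⟨⟨hcont, hmono, hzero⟩, htop⟩ := hγ
  refine ⟨⟨⟨hcont.sup (hcont.const_mul _), fun a ha b hb hab => ?_, by simp [hzero]⟩,
    tendsto_atTop_mono (fun r => le_max_left _ _) htop⟩, fun x ξ hx => (hjump x ξ).trans ?_⟩
  · exact max_lt_max (hmono ha hb hab)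
      (mul_lt_mul_of_pos_left (hmono ha hb hab) (Real.exp_pos d'))
  · refine max_le
      (mul_le_mul_of_nonneg_right (Real.exp_le_exp.2 (neg_le_neg hd'.le)) (hVnn x)) ?_
    rw [Real.exp_neg, le_inv_mul_iff₀ (Real.exp_pos d')]
    exact (le_max_right _ _).trans hx
end

section
/- Let d ≠ 0 and c, λ, μ be reals with λ, μ > 0, fix t₀ ∈ ℝ, and let T = (t_i)_{i≥1} be a strictly increasing sequence of reals with t_1 > t₀ and t_i → ∞. For t ≥ s ≥ t₀, let N(t,s) be the number of indices i with s < t_i ≤ t, and N*(t,s) the number of indices i with s ≤ t_i ≤ t. Then the following are equivalent: (a) −d·N(t,s) − (c − λ)·(t − s) ≤ μ for all t ≥ s ≥ t₀; (b) −d·N*(t,s) − (c − λ)·(t − s) ≤ μ for all t ≥ s ≥ t₀. -/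
open Set Filter Topology

/-- A linear bound which holds for all `x` near `s` along a nontrivial filter, with a count that is
eventually constant, persists at `s` itself. -/
theorem sub_mul_le_of_eventually_bound {l : Filter ℝ} [l.NeBot] {s : ℝ} (hl : l ≤ 𝓝 s)
    {a b t m : ℝ} {f : ℝ → ℕ} {n : ℕ} (hf : ∀ᶠ x in l, f x = n)
    (h : ∀ᶠ x in l, a * (f x : ℝ) - b * (t - x) ≤ m) :
    a * (n : ℝ) - b * (t - s) ≤ m := by
  have hcont : Continuous fun x : ℝ => a * (n : ℝ) - b * (t - x) := by fun_prop
  refine le_of_tendsto ((hcont.tendsto s).mono_left hl) ?_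
  filter_upwards [hf, h] with x hx hle
  rwa [hx] at hle

theorem finite_setOf_le_of_tendsto_atTop {T : ℕ → ℝ} (hT : Tendsto T atTop atTop) (t : ℝ) :
    {i | T i ≤ t}.Finite := by
  have h := hT.eventually_gt_atTop t
  rw [← Nat.cofinite_eq_atTop, eventually_cofinite] at h
  simpa using h

theorem eventually_nhdsLT_setOf_eq {T : ℕ → ℝ} {t : ℝ} (hfin : {i | T i ≤ t}.Finite) (s : ℝ) :
    ∀ᶠ x in 𝓝[<] s, {i | x < T i ∧ T i ≤ t} = {i | s ≤ T i ∧ T i ≤ t} := by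
  have h : ∀ᶠ x in 𝓝[<] s, ∀ i ∈ {i | T i ≤ t}, (x < T i ↔ s ≤ T i) := by
    refine (eventually_all_finite hfin).2 fun i _ => ?_
    rcases le_or_gt s (T i) with hi | hi
    · filter_upwards [self_mem_nhdsWithin] with x hx
      exact iff_of_true (lt_of_lt_of_le hx hi) hi
    · filter_upwards [nhdsWithin_le_nhds (lt_mem_nhds hi)] with x hx
      exact iff_of_false hx.not_gt hi.not_ge
  filter_upwards [h] with x hx
  ext i
  exact and_congr_left (hx i)

theorem eventually_nhdsGT_setOf_eq {T : ℕ → ℝ} {t : ℝ} (hfin : {i | T i ≤ t}.Finite) (s : ℝ) :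
    ∀ᶠ x in 𝓝[>] s, {i | x ≤ T i ∧ T i ≤ t} = {i | s < T i ∧ T i ≤ t} := by
  have h : ∀ᶠ x in 𝓝[>] s, ∀ i ∈ {i | T i ≤ t}, (x ≤ T i ↔ s < T i) := by
    refine (eventually_all_finite hfin).2 fun i _ => ?_
    rcases le_or_gt (T i) s with hi | hi
    · filter_upwards [self_mem_nhdsWithin] with x hx
      exact iff_of_false (lt_of_le_of_lt hi hx).not_ge hi.not_gt
    · filter_upwards [nhdsWithin_le_nhds (gt_mem_nhds hi)] with x hx
      exact iff_of_true hx.le hi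
  filter_upwards [h] with x hx
  ext i
  exact and_congr_left (hx i)

/-- the average dwell-time condition with the half-open counting
function `N(t,s) = #{i : s < t_i ≤ t}` is equivalent to the one with the closed
counting function `N*(t,s) = #{i : s ≤ t_i ≤ t}` (the classes `S[μ,λ]` and
`S*[μ,λ]` coincide). -/
theorem stmt_14 (c d lam mu t0 : ℝ) (hd : d ≠ 0) (hlam : 0 < lam) (hmu : 0 < mu)
    (T : ℕ → ℝ) (hT : StrictMono T) (h0 : t0 < T 0)
    (hTtop : Filter.Tendsto T Filter.atTop Filter.atTop) :
    (∀ s t : ℝ, t0 ≤ s → s ≤ t →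
        -d * (Set.ncard {i : ℕ | s < T i ∧ T i ≤ t} : ℝ)
          - (c - lam) * (t - s) ≤ mu) ↔
    (∀ s t : ℝ, t0 ≤ s → s ≤ t →
        -d * (Set.ncard {i : ℕ | s ≤ T i ∧ T i ≤ t} : ℝ)
          - (c - lam) * (t - s) ≤ mu) := by
  constructor
  · intro h s t hs hst
    rcases hs.eq_or_lt with rfl | hs
    · have hpos (i : ℕ) : t0 < T i := h0.trans_le (hT.monotone i.zero_le)
      simpa [hpos, (hpos _).le] using h t0 t le_rfl hst
    · refine sub_mul_le_of_eventually_bound (l := 𝓝[<] s) nhdsWithin_le_nhds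
        ((eventually_nhdsLT_setOf_eq (finite_setOf_le_of_tendsto_atTop hTtop t) s).mono
          fun x hx => congrArg Set.ncard hx) ?_
      filter_upwards [self_mem_nhdsWithin, nhdsWithin_le_nhds (lt_mem_nhds hs)] with x hxs hx0
      exact h x t hx0.le (hxs.le.trans hst)
  · intro h s t hs hst
    rcases hst.eq_or_lt with rfl | hst
    · have hempty : {i : ℕ | s < T i ∧ T i ≤ s} = ∅ :=
        Set.eq_empty_of_forall_notMem fun i hi => hi.1.not_ge hi.2
      simpa [hempty] using hmu.le
    · refine sub_mul_le_of_eventually_bound (l := 𝓝[>] s) nhdsWithin_le_nhds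
        ((eventually_nhdsGT_setOf_eq (finite_setOf_le_of_tendsto_atTop hTtop t) s).mono
          fun x hx => congrArg Set.ncard hx) ?_
      filter_upwards [self_mem_nhdsWithin, nhdsWithin_le_nhds (gt_mem_nhds hst)] with x hxs hxt
      exact h x t (hs.trans (le_of_lt hxs)) hxt.le
end

section
/- Let c > 0, d < 0 and λ ∈ (0, c), and set θ* := −d/(c − λ). Fix t₀ ∈ ℝ and let T = (t_i)_{i≥1} be a strictly increasing sequence of reals with t_1 > t₀ and t_i → ∞. For t ≥ s ≥ t₀, let N(t,s) be the number of indices i with s < t_i ≤ t. Then the following are equivalent: (a) t_{i+1} − t_i ≥ θ* for all i ≥ 1; (b) −d·N(t,s) − (c − λ)·(t − s) ≤ −d for all t ≥ s ≥ t₀. -/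
open Set Filter Topology

/-- A sequence tending to infinity has only finitely many terms in a bounded window. -/
theorem finite_indices_of_tendsto_atTop {T : ℕ → ℝ} (hT : Tendsto T atTop atTop) (s t : ℝ) :
    {i : ℕ | s < T i ∧ T i ≤ t}.Finite := by
  obtain ⟨K, hK⟩ := eventually_atTop.1 (hT.eventually_gt_atTop t)
  refine (Set.finite_Iio K).subset fun i hi => ?_
  by_contra h
  exact absurd hi.2 (not_le.2 (hK i (not_lt.1 h)))

/-- Increments bounded below by `θ` accumulate linearly. -/
theorem mul_le_sub_of_forall_le_sub_succ {T : ℕ → ℝ} {θ : ℝ}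
    (h : ∀ i, θ ≤ T (i + 1) - T i) (m k : ℕ) : (k : ℝ) * θ ≤ T (m + k) - T m := by
  induction k with
  | zero => simp
  | succ k ih =>
    have := h (m + k)
    rw [← add_assoc]
    push_cast
    linarith

/-- A window containing `n` terms with gaps at least `θ` has length at least `(n - 1) * θ`. -/
theorem ncard_sub_one_mul_le {T : ℕ → ℝ} {θ : ℝ} (hθ : 0 ≤ θ)
    (h : ∀ i, θ ≤ T (i + 1) - T i) (hT : Tendsto T atTop atTop) {s t : ℝ} (hst : s ≤ t) :
    ((Set.ncard {i : ℕ | s < T i ∧ T i ≤ t} : ℝ) - 1) * θ ≤ t - s := by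
  have hfin := finite_indices_of_tendsto_atTop hT s t
  set S := {i : ℕ | s < T i ∧ T i ≤ t}
  rcases S.eq_empty_or_nonempty with hS | hS
  · rw [hS, Set.ncard_empty]
    push_cast
    linarith
  obtain ⟨m, hm, hmin⟩ := Set.exists_min_image S id hfin hS
  obtain ⟨M, hM, hmax⟩ := Set.exists_max_image S id hfin hS
  obtain ⟨k, rfl⟩ := Nat.exists_eq_add_of_le (show m ≤ M from hmin M hM)
  have hcard : S.ncard ≤ k + 1 := by
    have hsub : S ⊆ (Finset.Icc m (m + k) : Set ℕ) := fun i hi => by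
      simpa using And.intro (hmin i hi) (hmax i hi)
    have := Set.ncard_le_ncard hsub (Finset.finite_toSet _)
    rw [Set.ncard_coe_finset, Nat.card_Icc] at this
    omega
  have hcard' : (S.ncard : ℝ) - 1 ≤ k := by
    have : (S.ncard : ℝ) ≤ k + 1 := by exact_mod_cast hcard
    linarith
  calc ((S.ncard : ℝ) - 1) * θ ≤ k * θ := mul_le_mul_of_nonneg_right hcard' hθ
    _ ≤ T (m + k) - T m := mul_le_sub_of_forall_le_sub_succ h m k
    _ ≤ t - s := sub_le_sub hM.2 hm.1.le

/-- for `c > 0`, `d < 0`, `λ ∈ (0,c)` and `θ* = -d/(c-λ)`, the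
fixed dwell-time condition `t_{i+1} - t_i ≥ θ*` is equivalent to the average
dwell-time condition `-d·N(t,s) - (c-λ)·(t-s) ≤ -d`, where
`N(t,s) = #{i : s < t_i ≤ t}` (i.e. `S_{θ*} = S[-d, λ]`). -/
theorem stmt_15 (c d lam t0 : ℝ) (hc : 0 < c) (hd : d < 0)
    (hlam0 : 0 < lam) (hlamc : lam < c)
    (T : ℕ → ℝ) (hT : StrictMono T) (h0 : t0 < T 0)
    (hTtop : Filter.Tendsto T Filter.atTop Filter.atTop) :
    (∀ i : ℕ, -d / (c - lam) ≤ T (i + 1) - T i) ↔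
    (∀ s t : ℝ, t0 ≤ s → s ≤ t →
        -d * (Set.ncard {i : ℕ | s < T i ∧ T i ≤ t} : ℝ)
          - (c - lam) * (t - s) ≤ -d) := by
  have hcl : 0 < c - lam := sub_pos.2 hlamc
  constructor
  · intro h s t _ hst
    have hθ : 0 ≤ -d / (c - lam) := div_nonneg (by linarith) hcl.le
    have key := ncard_sub_one_mul_le hθ h hTtop hst
    rw [← mul_div_assoc, div_le_iff₀ hcl] at key
    linarith
  · intro h i
    have hlt : t0 < T i := h0.trans_le (hT.monotone (Nat.zero_le i))
    suffices T i ≤ T (i + 1) - -d / (c - lam) by linarith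
    refine le_of_forall_lt_imp_le_of_dense fun a ha => ?_
    set s := max t0 a
    have hs : s < T i := max_lt hlt ha
    have hi : T i < T (i + 1) := hT (Nat.lt_succ_self i)
    have hcard : 2 ≤ Set.ncard {j : ℕ | s < T j ∧ T j ≤ T (i + 1)} := by
      rw [← Set.ncard_pair (Nat.succ_ne_self i).symm]
      refine Set.ncard_le_ncard ?_ (finite_indices_of_tendsto_atTop hTtop _ _)
      rintro j (rfl | rfl)
      · exact ⟨hs, hi.le⟩
      · exact ⟨hs.trans hi, le_rfl⟩
    have hcard' : (2 : ℝ) ≤ Set.ncard {j : ℕ | s < T j ∧ T j ≤ T (i + 1)} := by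
      exact_mod_cast hcard
    have key := h s (T (i + 1)) (le_max_left _ _) (hs.trans hi).le
    have hgap : -d / (c - lam) ≤ T (i + 1) - s := by
      rw [div_le_iff₀ hcl]
      nlinarith
    have has : a ≤ s := le_max_right _ _
    linarith
end
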